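/- arXiv:1911.02328 — 3 statements merged into one kernel-verified Lean document; each statement's English description precedes it below -/
import Mathlib

section
/- Let R be a Dedekind domain that is not a field and has only finitely many units. Then the subspace G_1(R) of the Golomb space G(R) is a regular topological space. -/
open Polynomial Filter

noncomputable section

/-- The Golomb space of a domain: the nonzero elements. -/
abbrev GolombSpace (R : Type*) [CommRing R] := {x : R // x ≠ 0}

/-- The Golomb topology: generated by coprime cosets `x + I`. -/
instance golombTopology (R : Type*) [CommRing R] : TopologicalSpace (GolombSpace R) :=
  TopologicalSpace.generateFrom
    {S : Set (GolombSpace R) | ∃ (x : R) (I : Ideal R), x ≠ 0 ∧ I ≠ ⊥ ∧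
      Ideal.span {x} ⊔ I = ⊤ ∧ S = {y : GolombSpace R | ∃ i ∈ I, (y : R) = x + i}}

/-- `G_n(R)`: nonzero elements contained in exactly `n` maximal ideals. -/
def golombGn (R : Type*) [CommRing R] (n : ℕ) : Set (GolombSpace R) :=
  {x | ∃ Δ : Finset (Ideal R), Δ.card = n ∧ (∀ P ∈ Δ, P.IsMaximal) ∧
    (∀ P : Ideal R, P.IsMaximal → ((x : R) ∈ P ↔ P ∈ Δ))}

/-- The `P`-topology on `R ∖ P`, generated by the cosets `a + Pⁿ`, `n ≥ 1`. -/
instance padicCosetTopology {R : Type*} [CommRing R] (P : Ideal R) :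
    TopologicalSpace {x : R // x ∉ P} :=
  TopologicalSpace.generateFrom
    {S : Set {x : R // x ∉ P} | ∃ (a : R) (n : ℕ), a ∉ P ∧ 1 ≤ n ∧
      S = {y : {x : R // x ∉ P} | ∃ b ∈ P ^ n, (y : R) = a + b}}

/-- Convergence of a sequence to `l` in the `P`-topology on `R ∖ P`. -/
def PTendsto {R : Type*} [CommRing R] (P : Ideal R) (s : ℕ → R) (l : R) : Prop :=
  ∃ (hl : l ∉ P) (hs : ∀ n, s n ∉ P),
    Filter.Tendsto (fun n => (⟨s n, hs n⟩ : {x : R // x ∉ P})) Filter.atTop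
      (nhds (⟨l, hl⟩ : {x : R // x ∉ P}))

/-- `⟨a⟩ = { u·aⁿ : u a unit, n ≥ 1 }`, as a subset of the Golomb space. -/
def golombPow {R : Type*} [CommRing R] (a : R) : Set (GolombSpace R) :=
  {y | ∃ (u : R) (n : ℕ), IsUnit u ∧ 1 ≤ n ∧ (y : R) = u * a ^ n}


theorem gol_bound {R : Type*} [CommRing R] [IsDomain R] [IsNoetherianRing R]
    (P : Ideal R) [hP : P.IsMaximal] (a : R) (ha : ∀ n : ℕ, 1 ≤ n → a ^ n - 1 ≠ 0) :
    ∃ B : ℕ, ∀ n : ℕ, 1 ≤ n → (n : R) ∉ P → ∀ s : ℕ, a ^ n - 1 ∈ P ^ s → s ≤ B := by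
  by_cases h : ∃ n0 : ℕ, 1 ≤ n0 ∧ a ^ n0 - 1 ∈ P
  · obtain ⟨n0, h1, h2⟩ := h
    have hb := Ideal.iInf_pow_eq_bot_of_isDomain P hP.ne_top
    have : ∃ B : ℕ, a ^ n0 - 1 ∉ P ^ B := by
      by_contra hcon
      push Not at hcon
      have : a ^ n0 - 1 ∈ (⨅ i : ℕ, P ^ i : Ideal R) := by
        rw [Submodule.mem_iInf]; exact hcon
      rw [hb] at this
      exact ha n0 h1 this
    obtain ⟨B, hB⟩ := this
    refine ⟨B, fun n hn hnP s hs => ?_⟩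
    by_contra hlt
    push Not at hlt
    have e1 : a ^ (n * n0) - 1 ∈ P ^ s := by
      have : a ^ n - 1 ∣ a ^ (n * n0) - 1 := by
        rw [pow_mul]; simpa using sub_dvd_pow_sub_pow (a ^ n) 1 n0
      exact Ideal.mem_of_dvd _ this hs
    have e2 : (∑ l ∈ Finset.range n, (a ^ n0) ^ l) * (a ^ n0 - 1) = a ^ (n * n0) - 1 := by
      rw [geom_sum_mul, ← pow_mul, mul_comm]
    have e3 : (∑ l ∈ Finset.range n, (a ^ n0) ^ l) ∉ P := by
      intro h3
      apply hnP
      rw [← Ideal.Quotient.eq_zero_iff_mem] at h3 ⊢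
      have : Ideal.Quotient.mk P a ^ n0 = 1 := by
        rw [← map_pow, ← sub_eq_zero, ← map_one (Ideal.Quotient.mk P), ← map_sub,
          Ideal.Quotient.eq_zero_iff_mem]; exact h2
      simpa [this] using h3
    rw [← e2] at e1
    rcases Ideal.IsMaximal.mul_mem_pow P e1 with h4 | h4
    · exact e3 h4
    · exact hB (Ideal.pow_le_pow_right hlt.le h4)
  · refine ⟨0, fun n hn hnP s hs => ?_⟩
    by_contra hlt
    exact h ⟨n, hn, Ideal.pow_le_self (by omega) hs⟩

theorem gol_fin {R : Type*} [CommRing R] [IsDomain R] (hu : Finite Rˣ) (I : Ideal R) :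
    {w : R | Ideal.span {w} = I}.Finite := by
  by_cases h : ∃ w0, Ideal.span {w0} = I
  · obtain ⟨w0, rfl⟩ := h
    refine (Set.finite_range (fun u : Rˣ => w0 * u)).subset ?_
    intro w hw
    obtain ⟨u, hu⟩ := Ideal.span_singleton_eq_span_singleton.1 (Eq.symm hw)
    exact ⟨u, hu⟩
  · convert Set.finite_empty
    ext w; simp; exact fun hw => h ⟨w, hw⟩

theorem gol_factor {R : Type*} [CommRing R] [IsDedekindDomain R]
    (P I : Ideal R) [hP : P.IsMaximal] (hP0 : P ≠ ⊥) (hI : I ≠ ⊥) :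
    ∃ (r : ℕ) (L : Ideal R), ¬ L ≤ P ∧ I = P ^ r * L := by
  have hPp : Prime P := Ideal.prime_of_isPrime hP0 hP.isPrime
  obtain ⟨r, L, h⟩ := WfDvdMonoid.max_power_factor hI hPp.irreducible
  exact ⟨r, L, fun h' => h.1 (Ideal.dvd_iff_le.2 h'), h.2⟩

set_option maxHeartbeats 400000 in
theorem gol_step {R : Type*} [CommRing R] [IsDedekindDomain R]
    (P Q : Ideal R) [hP : P.IsMaximal] [hQ : Q.IsMaximal] (x a : R)
    (hP0 : P ≠ ⊥) (hx : x ∈ P) (haQ : a ∈ Q) (ha0 : a ≠ 0)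
    (H : ∀ J : Ideal R, J ≠ ⊥ → ¬ J ≤ P → ¬ J ≤ Q → ∃ k : ℕ, x - a ^ k ∈ J)
    (i j : ℕ) (hi : 1 ≤ i) (hj : 1 ≤ j) :
    ∃ (n k r : ℕ) (w : R), 1 ≤ n ∧ n ∣ k * i + j ∧ a ^ n - 1 ∈ P ^ r ∧
      Ideal.span {w} = P ^ r ∧ w * (x ^ i * a ^ j - 1) = a ^ n - 1 := by
  obtain ⟨c, hc⟩ : ∃ c, c = x ^ i * a ^ j - 1 := ⟨_, rfl⟩
  rw [← hc]
  have hcP : c ∉ P := by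
    intro h
    apply hP.ne_top
    rw [Ideal.eq_top_iff_one]
    have : (1 : R) = x ^ i * a ^ j - c := by rw [hc]; ring
    rw [this]
    exact P.sub_mem (P.mul_mem_right _ (P.pow_mem_of_mem hx i hi)) h
  have hcQ : c ∉ Q := by
    intro h
    apply hQ.ne_top
    rw [Ideal.eq_top_iff_one]
    have : (1 : R) = x ^ i * a ^ j - c := by rw [hc]; ring
    rw [this]
    exact Q.sub_mem (Q.mul_mem_left _ (Q.pow_mem_of_mem haQ j hj)) h
  have hc0 : c ≠ 0 := fun h => hcP (h ▸ P.zero_mem)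
  -- congruence
  have cong : ∀ (J : Ideal R) (k : ℕ), x - a ^ k ∈ J → a ^ (k * i + j) - 1 - c ∈ J := by
    intro J k hk
    have e : a ^ (k * i + j) - 1 - c = - ((x ^ i - (a ^ k) ^ i) * a ^ j) := by
      rw [hc]; ring
    rw [e]
    exact J.neg_mem (J.mul_mem_right _ (Ideal.mem_of_dvd _ (sub_dvd_pow_sub_pow _ _ _) hk))
  have order : ∀ m : ℕ, c ∣ a ^ m - 1 ↔ Ideal.Quotient.mk (Ideal.span {c}) a ^ m = 1 := by
    intro m
    rw [← map_pow, ← sub_eq_zero, ← map_one (Ideal.Quotient.mk _), ← map_sub,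
          Ideal.Quotient.eq_zero_iff_mem, Ideal.mem_span_singleton]
  have hsub : ∀ (J : Ideal R), ∀ m, J ≤ Ideal.span {c} → a ^ m - 1 - c ∈ J → c ∣ a ^ m - 1 := by
    intro J m hJ hm
    have := hJ hm
    rw [Ideal.mem_span_singleton] at this
    exact (dvd_sub_self_right.1 this)
  obtain ⟨k0, hk0⟩ := H (Ideal.span {c}) (by simpa using hc0)
    (fun h => hcP (h (Ideal.mem_span_singleton_self c)))
    (fun h => hcQ (h (Ideal.mem_span_singleton_self c)))
  have h0 := hsub _ _ le_rfl (cong _ _ hk0)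
  rw [order] at h0
  obtain ⟨n, hn⟩ : ∃ n, n = orderOf (Ideal.Quotient.mk (Ideal.span {c}) a) := ⟨_, rfl⟩
  have hn1 : 1 ≤ n := hn ▸ orderOf_pos_iff.2 (isOfFinOrder_iff_pow_eq_one.2 ⟨_, by omega, h0⟩)
  have hdn : c ∣ a ^ n - 1 := (order n).2 (hn ▸ pow_orderOf_eq_one _)
  have hanQ : a ^ n - 1 ∉ Q := by
    intro h
    apply hQ.ne_top
    rw [Ideal.eq_top_iff_one]
    have : (1 : R) = a ^ n - (a ^ n - 1) := by ring
    rw [this]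
    exact Q.sub_mem (Q.pow_mem_of_mem haQ n hn1) h
  have han0 : a ^ n - 1 ≠ 0 := fun h => hanQ (h ▸ Q.zero_mem)
  obtain ⟨r, L, hL, hrL⟩ := gol_factor P (Ideal.span {a ^ n - 1}) hP0 (by simpa using han0)
  have hmem : a ^ n - 1 ∈ P ^ r * L := by
    rw [← hrL]; exact Ideal.mem_span_singleton_self _
  have hanL : a ^ n - 1 ∈ L := (Ideal.mul_le_right : P ^ r * L ≤ L) hmem
  have hanP : a ^ n - 1 ∈ P ^ r := (Ideal.mul_le_left : P ^ r * L ≤ P ^ r) hmem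
  have hL0 : L ≠ ⊥ := by
    intro h; rw [h] at hanL; exact han0 (by simpa using hanL)
  have hLc : L ≤ Ideal.span {c} := by
    rw [← Ideal.dvd_iff_le]
    have hcop : IsCoprime (Ideal.span {c}) (P ^ r) := by
      apply IsCoprime.pow_right
      rw [Ideal.isCoprime_iff_sup_eq, sup_comm]
      exact hP.1.2 _ (by
        rw [left_lt_sup, Ideal.span_singleton_le_iff_mem]; exact hcP)
    refine hcop.dvd_of_dvd_mul_left ?_
    rw [← hrL, Ideal.dvd_span_singleton, Ideal.mem_span_singleton]
    exact hdn
  obtain ⟨k, hk⟩ := H L hL0 hL (fun h => hanQ (h hanL))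
  have h1 := cong _ _ hk
  have h2 := hsub _ _ hLc h1
  have h3 : n ∣ k * i + j := hn ▸ orderOf_dvd_of_pow_eq_one ((order _).1 h2)
  have h4 : a ^ (k * i + j) - 1 ∈ L := by
    obtain ⟨q, hq⟩ := h3
    rw [hq, pow_mul]
    exact Ideal.mem_of_dvd _ (by simpa using sub_dvd_pow_sub_pow (a ^ n) 1 q) hanL
  have h5 : c ∈ L := by
    have := L.sub_mem h4 h1
    simpa using this
  have h6 : L = Ideal.span {c} := le_antisymm hLc ((Ideal.span_singleton_le_iff_mem _).2 h5)
  obtain ⟨w, hw⟩ := hdn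
  refine ⟨n, k, r, w, hn1, h3, hanP, ?_, by rw [hw, mul_comm]⟩
  rw [h6, hw, mul_comm c w, ← Ideal.span_singleton_mul_span_singleton] at hrL
  exact mul_right_cancel₀ (by simpa using hc0) hrL

theorem gol_K {R : Type*} [CommRing R] [IsDedekindDomain R] (hu : Finite Rˣ)
    (P Q : Ideal R) [hP : P.IsMaximal] [hQ : Q.IsMaximal] (x a : R)
    (hx0 : x ≠ 0) (hx : x ∈ P) (haQ : a ∈ Q) (ha0 : a ≠ 0) (haP : a ∉ P) :
    ∃ J : Ideal R, J ≠ ⊥ ∧ ¬ J ≤ P ∧ ¬ J ≤ Q ∧ ∀ k : ℕ, x - a ^ k ∉ J := by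
  by_contra hcon
  have H : ∀ J : Ideal R, J ≠ ⊥ → ¬ J ≤ P → ¬ J ≤ Q → ∃ k : ℕ, x - a ^ k ∈ J := by
    intro J h1 h2 h3
    by_contra h4
    push Not at h4
    exact hcon ⟨J, h1, h2, h3, h4⟩
  clear hcon
  have hP0 : P ≠ ⊥ := by
    intro h; rw [h] at hx; exact hx0 (by simpa using hx)
  have han : ∀ n : ℕ, 1 ≤ n → a ^ n - 1 ≠ 0 := by
    intro n hn h
    apply hQ.ne_top
    rw [Ideal.eq_top_iff_one, ← sub_eq_zero.1 h]
    exact Q.pow_mem_of_mem haQ n hn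
  obtain ⟨B, hB⟩ := gol_bound P a han
  obtain ⟨i, hi, hip⟩ : ∃ i : ℕ, 1 ≤ i ∧ ∀ n k t : ℕ, 1 ≤ n → n ∣ k * i + (1 + i * t) →
      (n : R) ∉ P := by
    obtain ⟨p, hp⟩ := CharP.exists (R ⧸ P)
    have key : ∀ n : ℕ, (n : R) ∈ P → p ∣ n := by
      intro n hn
      rw [← CharP.cast_eq_zero_iff (R ⧸ P) p n]
      rw [← Ideal.Quotient.eq_zero_iff_mem] at hn
      simpa using hn
    rcases Nat.eq_zero_or_pos p with rfl | hp0
    · refine ⟨1, le_rfl, fun n k t hn _ hnP => ?_⟩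
      have := key n hnP
      rw [zero_dvd_iff] at this
      omega
    · refine ⟨p, hp0, fun n k t hn hd hnP => ?_⟩
      have h1 := (key n hnP).trans hd
      have h2 : p ∣ 1 := by
        have e : k * p + (1 + p * t) = 1 + p * (k + t) := by ring
        rw [e] at h1
        exact (Nat.dvd_add_left (dvd_mul_right _ _)).1 h1
      have : p = 1 := Nat.dvd_one.1 h2
      subst this
      exact CharP.ringChar_ne_one (R := R ⧸ P) (ringChar.eq (R ⧸ P) 1)
  have step : ∀ t : ℕ, ∃ (n r : ℕ) (w : R), 1 ≤ n ∧ r ≤ B ∧ Ideal.span {w} = P ^ r ∧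
      w * (x ^ i * a ^ (1 + i * t) - 1) = a ^ n - 1 := by
    intro t
    obtain ⟨n, k, r, w, h1, h2, h3, h4, h5⟩ :=
      gol_step P Q x a hP0 hx haQ ha0 H i (1 + i * t) hi (by omega)
    exact ⟨n, r, w, h1, hB n h1 (hip n k t h1 h2) r h3, h4, h5⟩
  choose n r w hn hr hw hwn using step
  have hfin : (⋃ r ∈ Set.Iic B, {w : R | Ideal.span {w} = P ^ r}).Finite :=
    (Set.finite_Iic B).biUnion (fun r _ => gol_fin hu (P ^ r))
  have hfin2 : (Set.range w).Finite := by
    refine hfin.subset ?_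
    rintro _ ⟨t, rfl⟩
    simp only [Set.mem_iUnion]
    exact ⟨r t, hr t, hw t⟩
  -- pigeonhole
  obtain ⟨v, hv⟩ : ∃ v, {t : ℕ | w t = v}.Infinite := by
    by_contra hc
    push Not at hc
    have : (Set.univ : Set ℕ).Finite := by
      refine (hfin2.biUnion (fun v _ => hc v)).subset ?_
      intro t _
      simp
    exact Set.infinite_univ this
  have hxu : ∀ y : R, x * y ≠ 1 := by
    intro y h
    exact hP.ne_top ((Ideal.eq_top_iff_one P).2 (h ▸ P.mul_mem_right y hx))
  have hv0 : v ≠ 0 := by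
    obtain ⟨t, ht⟩ := hv.nonempty
    intro h
    have := hwn t
    rw [show w t = v from ht, h, zero_mul] at this
    exact han _ (hn t) this.symm
  have hinj : Set.InjOn n {t : ℕ | w t = v} := by
    intro t ht t' ht' h
    have e1 := hwn t
    have e2 := hwn t'
    rw [h, ← e2, show w t = v from ht, show w t' = v from ht'] at e1
    have e3 := mul_left_cancel₀ hv0 e1
    have e4 : a ^ (1 + i * t) = a ^ (1 + i * t') :=
      mul_left_cancel₀ (pow_ne_zero i hx0) (sub_left_injective e3)
    by_contra hne
    have aux : ∀ m l : ℕ, m < l → a ^ m ≠ a ^ l := by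
      intro m l hml he
      apply han (l - m) (by omega)
      apply mul_left_cancel₀ (pow_ne_zero m ha0)
      rw [mul_sub, ← pow_add, show m + (l - m) = l by omega, he]; ring
    rcases lt_or_gt_of_ne hne with h | h
    · exact aux _ _ (by nlinarith) e4
    · exact aux _ _ (by nlinarith) e4.symm
  have hbig : ∀ s : ℕ, ∃ t, w t = v ∧ s ≤ t ∧ s ≤ n t := by
    intro s
    have f1 : ({t : ℕ | w t = v} ∩ {t | n t < s}).Finite := by
      apply Set.Finite.of_finite_image (f := n)
      · refine (Set.finite_Iio s).subset ?_
        rintro _ ⟨t, ht, rfl⟩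
        exact ht.2
      · exact hinj.mono Set.inter_subset_left
    have f2 := (hv.sdiff f1).sdiff (Set.finite_Iio s)
    obtain ⟨t, ⟨h1, h2⟩, h3⟩ := f2.nonempty
    refine ⟨t, h1, by simpa using h3, ?_⟩
    by_contra h4
    exact h2 ⟨h1, by simpa using h4⟩
  have hv1 : v - 1 = 0 := by
    have hb := Ideal.iInf_pow_eq_bot_of_isDomain Q hQ.ne_top
    have : v - 1 ∈ (⨅ i : ℕ, Q ^ i : Ideal R) := by
      rw [Submodule.mem_iInf]
      intro s
      obtain ⟨t, h1, h2, h3⟩ := hbig s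
      have e := hwn t
      rw [h1] at e
      have e2 : v - 1 = v * x ^ i * a ^ (1 + i * t) - a ^ (n t) := by linear_combination -e
      rw [e2]
      have hm : ∀ m, s ≤ m → a ^ m ∈ Q ^ s := fun m hm =>
        Ideal.pow_le_pow_right hm (Ideal.pow_mem_pow haQ m)
      exact (Q ^ s).sub_mem ((Q ^ s).mul_mem_left _ (hm _ (by nlinarith))) (hm _ h3)
    rw [hb] at this
    simpa using this
  obtain ⟨t, ht⟩ := hv.nonempty
  have e := hwn t
  rw [show w t = v from ht, sub_eq_zero.1 hv1, one_mul] at e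
  have e2 := sub_left_injective e
  apply haP
  apply hP.isPrime.mem_of_pow_mem (n t)
  rw [← show x ^ i * a ^ (1 + i * t) = a ^ n t from e2]
  exact P.mul_mem_right _ (P.pow_mem_of_mem hx i hi)

/-- `y` is contained in the maximal ideal `Q` and in no other one. -/
def GolOnly {R : Type*} [CommRing R] (Q : Ideal R) (y : R) : Prop :=
  ∀ M : Ideal R, M.IsMaximal → (y ∈ M ↔ M = Q)

theorem gol_span {R : Type*} [CommRing R] [IsDedekindDomain R]
    (Q : Ideal R) [hQ : Q.IsMaximal] (y : R) (hy0 : y ≠ 0) (hy : GolOnly Q y) :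
    ∃ t : ℕ, 1 ≤ t ∧ Ideal.span {y} = Q ^ t := by
  have hyQ : y ∈ Q := (hy Q hQ).2 rfl
  have hQ0 : Q ≠ ⊥ := by
    intro h; rw [h] at hyQ; exact hy0 (by simpa using hyQ)
  obtain ⟨t, N, hN, ht⟩ := gol_factor Q (Ideal.span {y}) hQ0 (by simpa using hy0)
  have hyN : y ∈ N := by
    have : y ∈ Q ^ t * N := by rw [← ht]; exact Ideal.mem_span_singleton_self _
    exact (Ideal.mul_le_right : Q ^ t * N ≤ N) this
  have hNt : N = ⊤ := by
    by_contra h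
    obtain ⟨M, hM, hNM⟩ := Ideal.exists_le_maximal N h
    have := (hy M hM).1 (hNM hyN)
    exact hN (this ▸ hNM)
  rw [hNt, Ideal.mul_top] at ht
  refine ⟨t, ?_, ht⟩
  rcases Nat.eq_zero_or_pos t with h | h
  · exfalso
    rw [h, pow_zero, Ideal.one_eq_top] at ht
    apply hQ.ne_top
    rw [eq_top_iff, ← ht, Ideal.span_singleton_le_iff_mem]; exact hyQ
  · exact h

theorem gol_key {R : Type*} [CommRing R] [IsDedekindDomain R] (hu : Finite Rˣ)
    (P Q : Ideal R) [hP : P.IsMaximal] [hQ : Q.IsMaximal] (hPQ : P ≠ Q) (x : R)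
    (hx0 : x ≠ 0) (hx : x ∈ P) :
    ∃ J : Ideal R, J ≠ ⊥ ∧ ¬ J ≤ P ∧ ¬ J ≤ Q ∧ ∀ y : R, y ≠ 0 → GolOnly Q y → y - x ∉ J := by
  classical
  by_cases hex : ∃ t : ℕ, ∃ y : R, y ≠ 0 ∧ GolOnly Q y ∧ 1 ≤ t ∧ Ideal.span {y} = Q ^ t
  swap
  · refine ⟨⊤, top_ne_bot, fun h => hP.ne_top (top_le_iff.1 h),
      fun h => hQ.ne_top (top_le_iff.1 h), fun y h0 hy _ => ?_⟩
    obtain ⟨t, ht⟩ := gol_span Q y h0 hy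
    exact hex ⟨t, y, h0, hy, ht⟩
  obtain ⟨a, ha0, haQ, hs, hsp⟩ := Nat.find_spec hex
  have hmin := fun m => Nat.find_min hex (m := m)
  generalize Nat.find hex = s at hs hsp hmin
  have hQ0 : Q ≠ ⊥ := by
    intro h
    have := (haQ Q hQ).2 rfl
    rw [h] at this; exact ha0 (by simpa using this)
  -- every `Q`-only element is a unit times a power of `a`
  have hform : ∀ t : ℕ, ∀ y : R, Ideal.span {y} = Q ^ t → ∃ (u : Rˣ) (k : ℕ), y = u * a ^ k := by
    intro t
    induction t using Nat.strong_induction_on with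
    | _ t ih =>
      intro y hy
      have hy0 : y ≠ 0 := by
        intro h
        rw [h] at hy
        have : Q ^ t = ⊥ := by rw [← hy]; simp
        exact pow_ne_zero t hQ0 this
      rcases Nat.eq_zero_or_pos t with h | h
      · rw [h, pow_zero, Ideal.one_eq_top, Ideal.span_singleton_eq_top] at hy
        obtain ⟨u, rfl⟩ := hy
        exact ⟨u, 0, by simp⟩
      · have hyQ : GolOnly Q y := by
          intro M hM
          rw [← Ideal.span_singleton_le_iff_mem, hy]
          constructor
          · intro h1
            exact (hQ.eq_of_le hM.ne_top (hM.isPrime.le_of_pow_le h1)).symm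
          · rintro rfl
            exact Ideal.pow_le_self (by omega)
        have hst : s ≤ t := by
          by_contra hlt
          exact hmin t (by omega) ⟨y, hy0, hyQ, h, hy⟩
        have hay : a ∣ y := by
          rw [← Ideal.span_singleton_le_span_singleton, hy, hsp]
          exact Ideal.pow_le_pow_right hst
        obtain ⟨z, rfl⟩ := hay
        have hz : Ideal.span {z} = Q ^ (t - s) := by
          rw [← Ideal.span_singleton_mul_span_singleton, hsp,
            show t = s + (t - s) by omega, pow_add] at hy
          exact mul_left_cancel₀ (pow_ne_zero s hQ0) hy
        obtain ⟨u, k, rfl⟩ := ih (t - s) (by omega) z hz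
        exact ⟨u, k + 1, by ring⟩
  have haP : a ∉ P := fun h => hPQ ((haQ P hP).1 h)
  have hK : ∀ u : Rˣ, ∃ J : Ideal R, J ≠ ⊥ ∧ ¬ J ≤ P ∧ ¬ J ≤ Q ∧
      ∀ k : ℕ, ((u⁻¹ : Rˣ) : R) * x - a ^ k ∉ J := fun u =>
    gol_K hu P Q _ a (mul_ne_zero (Units.ne_zero _) hx0) (P.mul_mem_left _ hx)
      ((haQ Q hQ).2 rfl) ha0 haP
  choose J hJ0 hJP hJQ hJ using hK
  have := Fintype.ofFinite Rˣ
  refine ⟨∏ u, J u, ?_, ?_, ?_, ?_⟩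
  · exact Finset.prod_ne_zero_iff.2 (fun u _ => hJ0 u)
  · intro h
    obtain ⟨u, -, hu⟩ := (hP.isPrime.prod_le).1 h
    exact hJP u hu
  · intro h
    obtain ⟨u, -, hu⟩ := (hQ.isPrime.prod_le).1 h
    exact hJQ u hu
  · intro y hy0 hy hmem
    obtain ⟨t, -, ht⟩ := gol_span Q y hy0 hy
    obtain ⟨u, k, rfl⟩ := hform t y ht
    have h1 : (u : R) * a ^ k - x ∈ J u :=
      (Ideal.prod_le_inf.trans (Finset.inf_le (Finset.mem_univ u))) hmem
    apply hJ u k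
    have e : ((u⁻¹ : Rˣ) : R) * x - a ^ k = -((u⁻¹ : Rˣ) : R) * ((u : R) * a ^ k - x) := by
      have := u.inv_mul
      linear_combination (a ^ k) * this
    rw [e]
    exact (J u).mul_mem_left _ h1

theorem gol_open {R : Type*} [CommRing R] (x : R) (I : Ideal R) (hx : x ≠ 0) (hI : I ≠ ⊥)
    (h : Ideal.span {x} ⊔ I = ⊤) : IsOpen {y : GolombSpace R | (y : R) - x ∈ I} := by
  apply TopologicalSpace.isOpen_generateFrom_of_mem
  refine ⟨x, I, hx, hI, h, ?_⟩
  ext y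
  simp only [Set.mem_setOf_eq]
  constructor
  · intro hy; exact ⟨_, hy, by ring⟩
  · rintro ⟨i, hi, e⟩; rw [e]; simpa using hi

theorem gol_nhd {R : Type*} [CommRing R] [IsDomain R] (U : Set (GolombSpace R)) (hU : IsOpen U) :
    ∀ x ∈ U, ∃ I : Ideal R, I ≠ ⊥ ∧ Ideal.span {(x : R)} ⊔ I = ⊤ ∧
      ∀ y : GolombSpace R, (y : R) - x ∈ I → y ∈ U := by
  change TopologicalSpace.GenerateOpen _ U at hU
  induction hU with
  | basic S hS =>
    obtain ⟨z, I, hz, hI, htop, rfl⟩ := hS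
    rintro x ⟨i, hi, hx⟩
    refine ⟨I, hI, ?_, ?_⟩
    · rw [eq_top_iff, ← htop]
      refine sup_le ?_ le_sup_right
      rw [Ideal.span_singleton_le_iff_mem]
      have : z = (x : R) - i := by rw [hx]; ring
      rw [this]
      exact Ideal.sub_mem _ (Ideal.mem_sup_left (Ideal.mem_span_singleton_self _))
        (Ideal.mem_sup_right hi)
    · intro y hy
      refine ⟨((y : R) - x) + i, I.add_mem hy hi, ?_⟩
      rw [hx]; ring
  | univ => exact fun x _ => ⟨⊤, top_ne_bot, by simp, fun _ _ => trivial⟩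
  | inter S T _ _ ihS ihT =>
    rintro x ⟨h1, h2⟩
    obtain ⟨I, hI, hIx, hIS⟩ := ihS x h1
    obtain ⟨I', hI', hIx', hIT⟩ := ihT x h2
    have hl : I * I' ≤ I := Ideal.mul_le_left
    have hr : I * I' ≤ I' := Ideal.mul_le_right
    refine ⟨I * I', mul_ne_zero hI hI', ?_, fun y hy => ⟨hIS y (hl hy), hIT y (hr hy)⟩⟩
    rw [← Ideal.isCoprime_iff_sup_eq] at hIx hIx' ⊢
    exact hIx.mul_right hIx'
  | sUnion S _ ih =>
    rintro x ⟨T, hT, hx⟩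
    obtain ⟨I, h1, h2, h3⟩ := ih T hT x hx
    exact ⟨I, h1, h2, fun y hy => ⟨T, hT, h3 y hy⟩⟩

theorem gol_coprime {R : Type*} [CommRing R] (P J : Ideal R) (x : R) (hx : GolOnly P x)
    (hJ : ¬ J ≤ P) : Ideal.span {x} ⊔ J = ⊤ := by
  by_contra h
  obtain ⟨M, hM, hle⟩ := Ideal.exists_le_maximal _ h
  have h1 : x ∈ M := hle (Ideal.mem_sup_left (Ideal.mem_span_singleton_self _))
  have h2 := (hx M hM).1 h1
  exact hJ (h2 ▸ le_sup_right.trans hle)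

theorem gol_one {R : Type*} [CommRing R] (x : GolombSpace R) (hx : x ∈ golombGn R 1) :
    ∃ P : Ideal R, P.IsMaximal ∧ GolOnly P (x : R) := by
  obtain ⟨Δ, hΔ, h1, h2⟩ := hx
  obtain ⟨P, rfl⟩ := Finset.card_eq_one.1 hΔ
  exact ⟨P, h1 P (by simp), fun M hM => by rw [h2 M hM]; simp⟩

theorem gol_J {R : Type*} [CommRing R] [IsDedekindDomain R] (hu : Finite Rˣ)
    (P I : Ideal R) [hP : P.IsMaximal] (x : R) (hx0 : x ≠ 0) (hx : x ∈ P)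
    (hI : I ≠ ⊥) (hIP : ¬ I ≤ P) :
    ∃ J : Ideal R, J ≠ ⊥ ∧ J ≤ I ∧ ¬ J ≤ P ∧ ∀ Q : Ideal R, Q.IsMaximal → I ≤ Q →
      ∃ J' : Ideal R, J' ≠ ⊥ ∧ J ≤ J' ∧ ¬ J' ≤ Q ∧
        ∀ y : R, y ≠ 0 → GolOnly Q y → y - x ∉ J' := by
  classical
  have hfin : {Q : Ideal R | Q.IsMaximal ∧ I ≤ Q}.Finite := by
    refine ((Ideal.finite_factors hI).image (fun v => v.asIdeal)).subset ?_
    rintro Q ⟨hQ, hIQ⟩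
    have hQ0 : Q ≠ ⊥ := fun h => hI (le_bot_iff.1 (h ▸ hIQ))
    exact ⟨⟨Q, hQ.isPrime, hQ0⟩, Ideal.dvd_iff_le.2 hIQ, rfl⟩
  have hkey : ∀ Q : Ideal R, ∃ J : Ideal R, J ≠ ⊥ ∧ ¬ J ≤ P ∧ (Q.IsMaximal → I ≤ Q →
      ¬ J ≤ Q ∧ ∀ y : R, y ≠ 0 → GolOnly Q y → y - x ∉ J) := by
    intro Q
    by_cases h : Q.IsMaximal ∧ I ≤ Q
    · have := h.1
      obtain ⟨J, h1, h2, h3⟩ := gol_key hu P Q (fun e => hIP (e ▸ h.2)) x hx0 hx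
      exact ⟨J, h1, h2, fun _ _ => h3⟩
    · exact ⟨I, hI, hIP, fun h1 h2 => absurd ⟨h1, h2⟩ h⟩
  choose J hJ0 hJP hJ using hkey
  refine ⟨I * ∏ Q ∈ hfin.toFinset, J Q, ?_, Ideal.mul_le_left, ?_, ?_⟩
  · exact mul_ne_zero hI (Finset.prod_ne_zero_iff.2 (fun Q _ => hJ0 Q))
  · intro h
    rcases hP.isPrime.mul_le.1 h with h | h
    · exact hIP h
    · obtain ⟨u, -, hu⟩ := (hP.isPrime.prod_le).1 h
      exact hJP u hu
  · intro Q hQ hIQ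
    refine ⟨J Q, hJ0 Q, ?_, hJ Q hQ hIQ⟩
    exact Ideal.mul_le_right.trans (Ideal.prod_le_inf.trans
      (Finset.inf_le (by simpa using ⟨hQ, hIQ⟩)))

/-- If `R` is a Dedekind domain that is not a field and has only finitely many
units, then the subspace `G₁(R)` of the Golomb space `G(R)` is regular. -/
theorem golombG1_regularSpace (R : Type*) [CommRing R] [IsDomain R] [IsDedekindDomain R]
    (hnf : ¬ IsField R) (hu : Finite Rˣ) :
    RegularSpace (golombGn R 1) := by
  refine RegularSpace.of_exists_mem_nhds_isClosed_subset ?_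
  rintro ⟨x, hxG⟩ s hs
  obtain ⟨P, hP, hPx⟩ := gol_one x hxG
  have hxP : (x : R) ∈ P := (hPx P hP).2 rfl
  obtain ⟨U, hU, hUs⟩ := mem_nhds_subtype _ _ _ |>.1 hs
  obtain ⟨V, hVU, hVo, hxV⟩ := mem_nhds_iff.1 hU
  obtain ⟨I, hI0, hIx, hIV⟩ := gol_nhd V hVo x hxV
  have hIP : ¬ I ≤ P := by
    intro h
    apply hP.ne_top
    rw [eq_top_iff, ← hIx]
    exact sup_le ((Ideal.span_singleton_le_iff_mem _).2 hxP) h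
  obtain ⟨J, hJ0, hJI, hJP, hJ⟩ := gol_J hu P I (x : R) x.2 hxP hI0 hIP
  have hopen : ∀ (y : golombGn R 1) (K : Ideal R), K ≠ ⊥ → Ideal.span {(y.1 : R)} ⊔ K = ⊤ →
      {z : golombGn R 1 | (z.1 : R) - (y.1 : R) ∈ K} ∈ nhds y := by
    intro y K h1 h2
    refine IsOpen.mem_nhds
      ((gol_open (y.1 : R) K y.1.2 h1 h2).preimage continuous_subtype_val) ?_
    simp
  refine ⟨closure {z : golombGn R 1 | (z.1 : R) - (x : R) ∈ J}, ?_, isClosed_closure, ?_⟩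
  · exact mem_of_superset (hopen ⟨x, hxG⟩ J hJ0 (gol_coprime P J x hPx hJP)) subset_closure
  · intro y hy
    apply hUs
    apply hVU
    apply hIV
    obtain ⟨Q, hQ, hQy⟩ := gol_one y.1 y.2
    have meet : ∀ K : Ideal R, K ≠ ⊥ → ¬ K ≤ Q → J ≤ K → (y.1 : R) - (x : R) ∈ K := by
      intro K h1 h2 h3
      obtain ⟨z, hz1, hz2⟩ := mem_closure_iff_nhds.1 hy _ (hopen y K h1 (gol_coprime Q K _ hQy h2))
      have := K.sub_mem (h3 hz2) hz1
      simpa using this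
    by_cases hIQ : I ≤ Q
    · obtain ⟨J', h1, h2, h3, h4⟩ := hJ Q hQ hIQ
      exact absurd (meet J' h1 h3 h2) (h4 _ y.1.2 hQy)
    · exact meet I hI0 hIQ hJI

end
end

section
/- Let K and K' be separably closed fields, of characteristic p and p' respectively. If the Golomb spaces G(K[X]) and G(K'[X]) are homeomorphic, then p = p'. -/
open Polynomial Filter

noncomputable section

section GolombTop
open Topology

variable {X Y : Type*} [TopologicalSpace X] [TopologicalSpace Y]

/-- Filter generated by intersections of closures of neighbourhoods of two points. -/
def gPhi (x y : X) : Filter X := (𝓝 x).lift' closure ⊓ (𝓝 y).lift' closure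

/-- Topological characterization of units. -/
def gIsU (u : X) : Prop := ∃ y : X, y ≠ u ∧ ∀ x' y' : X, gPhi u y ≤ gPhi x' y'

/-- Topological characterization of the inclusion of supports. -/
def gLe (x y : X) : Prop := ∀ u : X, gIsU u → u ≠ x → u ≠ y → gPhi x u ≤ gPhi y u

variable (X) in
/-- Topological characterization of the (nonzero parts of) prime ideals. -/
def gPP : Set (Set X) :=
  {C | ∃ x : X, ¬ gIsU x ∧ (∀ y : X, ¬ gIsU y → gLe y x → gLe x y) ∧ C = {y | gLe x y}}

/-- The trace of the `P`-adic neighbourhood filter. -/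
def gFF (u : X) (C : Set X) : Filter X :=
  ⨅ W ∈ {W : Set X | W ⊆ Cᶜ ∧ IsOpen W ∧ IsOpen (Cᶜ \ W) ∧ u ∈ W}, 𝓟 W

/-- Elements supported exactly at `A`. -/
def gAA (A : Set X) : Set X := {x | x ∈ A ∧ ∀ C ∈ gPP X, x ∈ C → C = A}

/-- The primes whose germ contains the intersection of two germs. -/
def gQQ (u : X) (A P Q : Set X) : Set (Set X) :=
  {Q' | Q' ∈ gPP X ∧ gFF u P ⊓ gFF u Q ⊓ 𝓟 (gAA A) ≤ gFF u Q'}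

variable (X) in
/-- The numbers of primes achieved. -/
def gAch : Set ℕ :=
  {N | ∃ u : X, gIsU u ∧ ∃ A ∈ gPP X, ∃ P ∈ gPP X, ∃ Q ∈ gPP X, (gQQ u A P Q).ncard = N}

theorem gPhi_map (h : X ≃ₜ Y) (x y : X) : gPhi (h x) (h y) = (gPhi x y).map h := by
  have key : ∀ x : X, (𝓝 (h x)).lift' closure = ((𝓝 x).lift' closure).map h := by
    intro x
    rw [Filter.map_lift'_eq (monotone_closure X), ← h.map_nhds_eq,
      Filter.map_lift'_eq2 (monotone_closure Y)]
    congr 1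
    funext s
    exact (h.image_closure s).symm
  unfold gPhi
  rw [Filter.map_inf h.injective, key, key]

theorem gPhi_le (h : X ≃ₜ Y) (x y x' y' : X) :
    gPhi (h x) (h y) ≤ gPhi (h x') (h y') ↔ gPhi x y ≤ gPhi x' y' := by
  rw [gPhi_map, gPhi_map, Filter.map_le_map_iff h.injective]

theorem gIsU_map (h : X ≃ₜ Y) (x : X) : gIsU (h x) ↔ gIsU x := by
  unfold gIsU
  rw [h.surjective.exists]
  simp only [h.surjective.forall, gPhi_le, h.injective.ne_iff]

theorem gLe_map (h : X ≃ₜ Y) (x y : X) : gLe (h x) (h y) ↔ gLe x y := by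
  unfold gLe
  simp only [h.surjective.forall, gPhi_le, h.injective.ne_iff, gIsU_map]

theorem gPP_map (h : X ≃ₜ Y) (C : Set X) : h '' C ∈ gPP Y ↔ C ∈ gPP X := by
  unfold gPP
  simp only [Set.mem_ofPred_eq, h.surjective.exists, h.surjective.forall, gIsU_map, gLe_map]
  refine exists_congr fun x => and_congr_right fun _ => and_congr_right fun _ => ?_
  have : {y | gLe (h x) y} = h '' {y | gLe x y} := by
    ext y
    obtain ⟨y, rfl⟩ := h.surjective y
    simp [gLe_map]
  rw [this, h.injective.image_injective.eq_iff]

theorem gFF_map (h : X ≃ₜ Y) (u : X) (C : Set X) : gFF (h u) (h '' C) = (gFF u C).map h := by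
  have hs : Function.Surjective (fun s : Set X => h '' s) := h.surjective.image_surjective
  have : gFF u C = Filter.comap h (gFF (h u) (h '' C)) := by
    unfold gFF
    simp only [Filter.comap_iInf, Filter.comap_principal, hs.iInf_comp
      (g := fun W => ⨅ (_ : W ∈ {W : Set Y | W ⊆ (h '' C)ᶜ ∧ IsOpen W ∧ IsOpen ((h '' C)ᶜ \ W)
        ∧ h u ∈ W}), 𝓟 (h ⁻¹' W))|>.symm]
    refine iInf_congr fun W => ?_
    have e : h ⁻¹' (h '' W) = W := h.injective.preimage_image W
    rw [e]
    refine iInf_congr_Prop ?_ (fun _ => rfl)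
    simp only [Set.mem_ofPred_eq]
    rw [← Set.image_compl_eq h.bijective, ← Set.image_sdiff h.injective,
      Set.image_subset_image_iff h.injective, h.isOpen_image, h.isOpen_image,
      h.injective.mem_set_image]
  rw [this, Filter.map_comap_of_surjective h.surjective]

theorem gAA_map (h : X ≃ₜ Y) (A : Set X) : gAA (h '' A) = h '' gAA A := by
  have hs : Function.Surjective (fun s : Set X => h '' s) := h.surjective.image_surjective
  ext y
  obtain ⟨y, rfl⟩ := h.surjective y
  rw [h.injective.mem_set_image]
  unfold gAA
  simp only [Set.mem_ofPred_eq, hs.forall, gPP_map, h.injective.mem_set_image,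
    h.injective.image_injective.eq_iff]

theorem gQQ_map (h : X ≃ₜ Y) (u : X) (A P Q : Set X) :
    gQQ (h u) (h '' A) (h '' P) (h '' Q) = (fun s => h '' s) '' gQQ u A P Q := by
  have hs : Function.Surjective (fun s : Set X => h '' s) := h.surjective.image_surjective
  ext C
  obtain ⟨C, rfl⟩ := hs C
  rw [h.injective.image_injective.mem_set_image]
  unfold gQQ
  simp only [Set.mem_ofPred_eq, gPP_map, gFF_map, gAA_map]
  rw [← Filter.map_principal, ← Filter.map_inf h.injective, ← Filter.map_inf h.injective,
    Filter.map_le_map_iff h.injective]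

theorem gAch_mono (h : X ≃ₜ Y) : gAch X ⊆ gAch Y := by
  rintro N ⟨u, hu, A, hA, P, hP, Q, hQ, hN⟩
  refine ⟨h u, (gIsU_map h u).2 hu, h '' A, (gPP_map h A).2 hA, h '' P, (gPP_map h P).2 hP,
    h '' Q, (gPP_map h Q).2 hQ, ?_⟩
  rw [gQQ_map, Set.ncard_image_of_injective _ h.injective.image_injective, hN]

end GolombTop

section GolombPoly
open Topology

variable {K : Type*} [Field K]

/-- The coset `x + (b)` in the Golomb space. -/
def gCo (x b : K[X]) : Set (GolombSpace K[X]) := {y | b ∣ y.1 - x}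

theorem mem_gCo {x b : K[X]} {y : GolombSpace K[X]} : y ∈ gCo x b ↔ b ∣ y.1 - x := Iff.rfl

theorem isOpen_gCo {x b : K[X]} (hx : x ≠ 0) (hb : b ≠ 0) (h : IsCoprime x b) :
    IsOpen (gCo x b) := by
  refine TopologicalSpace.isOpen_generateFrom_of_mem ⟨x, Ideal.span {b}, hx, ?_, ?_, ?_⟩
  · simpa using hb
  · rwa [← Ideal.isCoprime_iff_sup_eq, Ideal.isCoprime_span_singleton_iff]
  · ext y
    simp only [mem_gCo, Set.mem_ofPred_eq, Ideal.mem_span_singleton]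
    constructor
    · intro h
      exact ⟨_, h, by ring⟩
    · rintro ⟨i, hi, e⟩
      rw [e]
      simpa using hi

theorem exists_gCo {U : Set (GolombSpace K[X])} (hU : IsOpen U) :
    ∀ x ∈ U, ∃ b : K[X], (b ≠ 0 ∧ IsCoprime x.1 b) ∧ gCo x.1 b ⊆ U := by
  induction hU with
  | basic s hs =>
    obtain ⟨x₀, I, hx₀, hI, hc, rfl⟩ := hs
    rintro x ⟨i, hi, e⟩
    obtain ⟨b, rfl⟩ := (IsPrincipalIdealRing.principal I).principal
    have hi' : b ∣ i := Ideal.mem_span_singleton.1 hi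
    refine ⟨b, ⟨?_, ?_⟩, ?_⟩
    · rintro rfl
      simp at hI
    · have h1 : IsCoprime x₀ b := by
        rw [← Ideal.isCoprime_span_singleton_iff, Ideal.isCoprime_iff_sup_eq]
        exact hc
      obtain ⟨d, rfl⟩ := hi'
      rw [e]
      exact h1.add_mul_left_left d
    · intro y hy
      refine ⟨y.1 - x₀, Ideal.mem_span_singleton.2 ?_, by ring⟩
      rw [mem_gCo, e] at hy
      have := dvd_add hy hi'
      rwa [show y.1 - (x₀ + i) + i = y.1 - x₀ by ring] at this
  | univ => exact fun x _ => ⟨1, ⟨one_ne_zero, isCoprime_one_right⟩, Set.subset_univ _⟩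
  | inter s t _ _ ihs iht =>
    rintro x ⟨hxs, hxt⟩
    obtain ⟨b, ⟨hb, hbx⟩, hbs⟩ := ihs x hxs
    obtain ⟨c, ⟨hc, hcx⟩, hct⟩ := iht x hxt
    exact ⟨b * c, ⟨mul_ne_zero hb hc, hbx.mul_right hcx⟩, fun y hy =>
      ⟨hbs ((dvd_mul_right b c).trans hy), hct ((dvd_mul_left c b).trans hy)⟩⟩
  | sUnion S _ ih =>
    rintro x ⟨s, hs, hx⟩
    obtain ⟨b, hb, hbs⟩ := ih s hs x hx
    exact ⟨b, hb, hbs.trans (Set.subset_sUnion_of_mem hs)⟩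

theorem nhds_gBasis (x : GolombSpace K[X]) :
    (𝓝 x).HasBasis (fun b : K[X] => b ≠ 0 ∧ IsCoprime x.1 b) (gCo x.1) := by
  constructor
  intro t
  constructor
  · intro ht
    obtain ⟨U, hUt, hU, hx⟩ := mem_nhds_iff.1 ht
    obtain ⟨b, hb, hbU⟩ := exists_gCo hU x hx
    exact ⟨b, hb, hbU.trans hUt⟩
  · rintro ⟨b, hb, hbt⟩
    exact mem_of_superset ((isOpen_gCo x.2 hb.1 hb.2).mem_nhds (by simp [mem_gCo])) hbt

theorem mem_closure_gCo {x b₁ b₂ : K[X]} {y : GolombSpace K[X]} (hb : b₁ * b₂ ≠ 0)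
    (h1 : ∀ q : K[X], Prime q → q ∣ b₁ → q ∣ y.1) (h2 : b₂ ∣ y.1 - x) :
    y ∈ closure (gCo x (b₁ * b₂)) := by
  rw [mem_closure_iff_nhds_basis (nhds_gBasis y)]
  rintro c ⟨hc, hyc⟩
  have hcop : IsCoprime c b₁ := by
    refine isCoprime_of_prime_dvd (fun h => hc h.1) ?_
    intro q hq hqc hqb
    exact hq.not_isUnit (hyc.isUnit_of_dvd' (h1 q hq hqb) hqc)
  obtain ⟨s, t, hst⟩ := hcop
  obtain ⟨d, hd⟩ := h2
  obtain ⟨m, hm⟩ : ∃ m, b₁ * b₂ ∣ y.1 + c * m - x := by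
    refine ⟨- b₂ * d * s, d * t, ?_⟩
    linear_combination hd + (-b₂ * d) * hst
  by_cases h0 : y.1 + c * m = 0
  · refine ⟨⟨y.1 + c * m + c * (b₁ * b₂), ?_⟩, ?_, ?_⟩
    · rw [h0, zero_add]
      exact mul_ne_zero hc hb
    · rw [mem_gCo]
      have := dvd_add hm (dvd_mul_left (b₁ * b₂) c)
      rwa [show y.1 + c * m - x + c * (b₁ * b₂) = y.1 + c * m + c * (b₁ * b₂) - x by ring] at this
    · exact ⟨m + b₁ * b₂, by ring⟩
  · exact ⟨⟨_, h0⟩, hm, ⟨m, by ring⟩⟩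

theorem mem_closure_gCo_one {x b : K[X]} {y : GolombSpace K[X]} (hb : b ≠ 0)
    (h1 : ∀ q : K[X], Prime q → q ∣ b → q ∣ y.1) : y ∈ closure (gCo x b) := by
  have := mem_closure_gCo (x := x) (y := y) (b₁ := b) (b₂ := 1) (by simpa using hb) h1 (one_dvd _)
  rwa [mul_one] at this

theorem gcop_of_isUnit {x : K[X]} (hx : IsUnit x) (b : K[X]) : IsCoprime x b := by
  obtain ⟨u, rfl⟩ := hx
  exact ⟨((u⁻¹ : K[X]ˣ) : K[X]), 0, by simp⟩

theorem dvd_of_mem_closure_gCo {x b q : K[X]} {y : GolombSpace K[X]} (hq : Prime q) (n : ℕ)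
    (hy : y ∈ closure (gCo x b)) (hqy : ¬ q ∣ y.1) (hb : q ^ n ∣ b) : q ^ n ∣ y.1 - x := by
  rw [mem_closure_iff_nhds_basis (nhds_gBasis y)] at hy
  have hc : IsCoprime y.1 (q ^ n) :=
    (((Irreducible.coprime_iff_not_dvd hq.irreducible).2 hqy).symm).pow_right
  obtain ⟨z, hz1, hz2⟩ := hy (q ^ n) ⟨pow_ne_zero _ hq.ne_zero, hc⟩
  have := dvd_sub (hb.trans hz1) hz2
  rwa [show z.1 - x - (z.1 - y.1) = y.1 - x by ring] at this

theorem mem_gPhi {x y : GolombSpace K[X]} {S : Set (GolombSpace K[X])} :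
    S ∈ gPhi x y ↔ ∃ b c : K[X], (b ≠ 0 ∧ IsCoprime x.1 b) ∧ (c ≠ 0 ∧ IsCoprime y.1 c) ∧
      closure (gCo x.1 b) ∩ closure (gCo y.1 c) ⊆ S := by
  unfold gPhi
  rw [((nhds_gBasis x).lift'_closure.inf (nhds_gBasis y).lift'_closure).mem_iff]
  constructor
  · rintro ⟨⟨b, c⟩, ⟨hb, hc⟩, h⟩
    exact ⟨b, c, hb, hc, h⟩
  · rintro ⟨b, c, hb, hc, h⟩
    exact ⟨⟨b, c⟩, ⟨hb, hc⟩, h⟩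

theorem exists_not_pow_dvd {q x : K[X]} (hq : Prime q) (hx : x ≠ 0) :
    ∃ n : ℕ, 1 ≤ n ∧ ¬ q ^ n ∣ x := by
  obtain ⟨n, hn⟩ := FiniteMultiplicity.of_prime_left hq hx
  exact ⟨n + 1, by omega, hn⟩

theorem split_pow {q b : K[X]} (hq : Prime q) (hb : b ≠ 0) :
    ∃ (n : ℕ) (c : K[X]), b = q ^ n * c ∧ ¬ q ∣ c := by
  obtain ⟨c, h1, h2⟩ := (FiniteMultiplicity.of_prime_left hq hb).exists_eq_pow_mul_and_not_dvd
  exact ⟨_, c, h1, h2⟩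

theorem coprime_of_not_dvd {q x : K[X]} (hq : Prime q) (h : ¬ q ∣ x) (n : ℕ) :
    IsCoprime x (q ^ n) :=
  (((Irreducible.coprime_iff_not_dvd hq.irreducible).2 h).symm).pow_right

theorem not_dvd_of_coprime {q x b : K[X]} (hq : Prime q) (h : IsCoprime x b) (hx : q ∣ x) :
    ¬ q ∣ b := fun hb => hq.not_isUnit (h.isUnit_of_dvd' hx hb)

/-- The nonzero multiples of `q`. -/
def gI (q : K[X]) : Set (GolombSpace K[X]) := {z | q ∣ z.1}

theorem mem_gI {q : K[X]} {z : GolombSpace K[X]} : z ∈ gI q ↔ q ∣ z.1 := Iff.rfl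

theorem gI_mem_gPhi {q : K[X]} (hq : Prime q) {x y : GolombSpace K[X]} (hxy : x ≠ y)
    (hx : ¬ q ∣ x.1) (hy : ¬ q ∣ y.1) : gI q ∈ gPhi x y := by
  have hne : y.1 - x.1 ≠ 0 := fun h => hxy (Subtype.ext (sub_eq_zero.1 h).symm)
  obtain ⟨n, hn, hnd⟩ := exists_not_pow_dvd hq hne
  rw [mem_gPhi]
  refine ⟨q ^ n, q ^ n, ⟨pow_ne_zero _ hq.ne_zero, coprime_of_not_dvd hq hx n⟩,
    ⟨pow_ne_zero _ hq.ne_zero, coprime_of_not_dvd hq hy n⟩, ?_⟩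
  rintro z ⟨hz1, hz2⟩
  by_contra hz
  have h1 := dvd_of_mem_closure_gCo hq n hz1 hz dvd_rfl
  have h2 := dvd_of_mem_closure_gCo hq n hz2 hz dvd_rfl
  apply hnd
  have := dvd_sub h1 h2
  rwa [show z.1 - x.1 - (z.1 - y.1) = y.1 - x.1 by ring] at this

theorem gI_notMem_gPhi {q : K[X]} (hq : Prime q) {x y : GolombSpace K[X]}
    (hx : q ∣ x.1) : gI q ∉ gPhi x y := by
  rw [mem_gPhi]
  rintro ⟨b, c, ⟨hb, hxb⟩, ⟨hc, hyc⟩, hsub⟩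
  have hqb : ¬ q ∣ b := not_dvd_of_coprime hq hxb hx
  by_cases hqc : q ∣ c
  · have hqy : ¬ q ∣ y.1 := not_dvd_of_coprime hq hyc.symm hqc
    obtain ⟨n, c', rfl, hqc'⟩ := split_pow hq hc
    have hn : n ≠ 0 := by
      rintro rfl
      simp at hqc
      exact hqc' hqc
    have hbc : ¬ q ∣ b * c' := fun h => (hq.dvd_or_dvd h).elim hqb hqc'
    obtain ⟨s, t, hst⟩ := coprime_of_not_dvd hq hbc n
    have hqz : ¬ q ∣ y.1 * s * (b * c') := by
      intro h
      have h2 : q ∣ y.1 * t * q ^ n := (dvd_pow_self q hn).mul_left _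
      have := dvd_add h h2
      rw [show y.1 * s * (b * c') + y.1 * t * q ^ n = y.1 * (s * (b * c') + t * q ^ n) by ring,
        hst, mul_one] at this
      exact hqy this
    have hz0 : y.1 * s * (b * c') ≠ 0 := fun h => hqz (by rw [h]; exact dvd_zero q)
    refine hqz (hsub (a := ⟨_, hz0⟩) ⟨?_, ?_⟩)
    · refine mem_closure_gCo_one hb (fun r _ hr => ?_)
      exact (hr.mul_right _).mul_left _
    · rw [mul_comm]
      refine mem_closure_gCo (by rwa [mul_comm]) (fun r _ hr => ?_) ?_
      · exact (hr.mul_left _).mul_left _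
      · exact ⟨- y.1 * t, by linear_combination y.1 * hst⟩
  · have hqz : ¬ q ∣ b * c := fun h => (hq.dvd_or_dvd h).elim hqb hqc
    refine hqz (hsub (a := ⟨_, mul_ne_zero hb hc⟩) ⟨?_, ?_⟩)
    · refine mem_closure_gCo_one hb (fun r _ hr => ?_)
      simpa using hr.mul_right c
    · refine mem_closure_gCo_one hc (fun r _ hr => ?_)
      simpa using hr.mul_left b

theorem exists_other_unit [Infinite K] (s : Set (GolombSpace K[X])) (hs : s.Finite) :
    ∃ u : GolombSpace K[X], IsUnit u.1 ∧ u ∉ s := by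
  have : Set.Infinite {u : GolombSpace K[X] | IsUnit u.1} := by
    have hinf : Infinite Kˣ := by
      have h1 : ({0}ᶜ : Set K).Infinite := (Set.finite_singleton (0 : K)).infinite_compl
      have := h1.to_subtype
      exact Infinite.of_injective (fun x : ({0}ᶜ : Set K) => Units.mk0 x.1 x.2)
        (fun a b h => Subtype.ext (congrArg Units.val h))
    let f : Kˣ → GolombSpace K[X] := fun c => ⟨C c.1, by simp⟩
    have hf : Function.Injective f := by
      intro a b hab
      exact Units.ext (C_injective (congrArg Subtype.val hab))
    refine (Set.infinite_range_of_injective hf).mono ?_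
    rintro _ ⟨c, rfl⟩
    exact isUnit_C.2 c.isUnit
  obtain ⟨u, hu, hus⟩ := (this.sdiff hs).nonempty
  exact ⟨u, hu, hus⟩

theorem gIsU_iff [Infinite K] (x : GolombSpace K[X]) : gIsU x ↔ IsUnit x.1 := by
  constructor
  · rintro ⟨y, hy, h⟩
    by_contra hx
    obtain ⟨q, hq, hqx⟩ := WfDvdMonoid.exists_irreducible_factor hx x.2
    have hq := hq.prime
    obtain ⟨u, hu, -⟩ := exists_other_unit (K := K) ∅ Set.finite_empty
    obtain ⟨v, hv, hvu⟩ := exists_other_unit (K := K) {u} (Set.finite_singleton u)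
    refine gI_notMem_gPhi hq hqx (h u v (gI_mem_gPhi hq (fun e => hvu (by simp [e])) ?_ ?_))
    · exact fun h => hq.not_isUnit (isUnit_of_dvd_unit h hu)
    · exact fun h => hq.not_isUnit (isUnit_of_dvd_unit h hv)
  · intro hx
    obtain ⟨v, hv, hvx⟩ := exists_other_unit (K := K) {x} (Set.finite_singleton x)
    refine ⟨v, fun e => hvx (by simp [e]), fun x' y' S hS => ?_⟩
    rw [mem_gPhi] at hS ⊢
    obtain ⟨b, c, ⟨hb, hxb⟩, ⟨hc, hyc⟩, hsub⟩ := hS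
    have hbc := mul_ne_zero hb hc
    refine ⟨b * c, b * c, ⟨hbc, gcop_of_isUnit hx _⟩, ⟨hbc, gcop_of_isUnit hv _⟩,
      fun z hz => hsub ?_⟩
    have key : ∀ q : K[X], Prime q → q ∣ b * c → q ∣ z.1 := by
      intro q hq hqb
      by_contra hqz
      have h1 := dvd_of_mem_closure_gCo hq 1 hz.1 hqz (by simpa using hqb)
      have h2 := dvd_of_mem_closure_gCo hq 1 hz.2 hqz (by simpa using hqb)
      have h3 := dvd_sub h1 h2
      rw [show z.1 - x.1 - (z.1 - v.1) = v.1 - x.1 by ring, pow_one] at h3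
      obtain ⟨a, ha, hax⟩ := Polynomial.isUnit_iff.1 hx
      obtain ⟨d, hd, hdv⟩ := Polynomial.isUnit_iff.1 hv
      rw [← hax, ← hdv, ← C_sub] at h3
      refine hq.not_isUnit (isUnit_of_dvd_unit h3 (isUnit_C.2 (isUnit_iff_ne_zero.2 ?_)))
      intro e
      apply hvx
      rw [Set.mem_singleton_iff]
      apply Subtype.ext
      rw [← hax, ← hdv, sub_eq_zero.1 e]
    constructor
    · rw [← mul_one b]
      exact mem_closure_gCo (by simpa using hb) (fun r hr hrb => key r hr (hrb.mul_right c))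
        (one_dvd _)
    · rw [← mul_one c]
      exact mem_closure_gCo (by simpa using hc) (fun r hr hrb => key r hr (hrb.mul_left b))
        (one_dvd _)

theorem gLe_iff [Infinite K] (x y : GolombSpace K[X]) :
    gLe x y ↔ ∀ q : K[X], Prime q → q ∣ x.1 → q ∣ y.1 := by
  constructor
  · intro h q hq hqx
    obtain ⟨u, hu, hux⟩ := exists_other_unit (K := K) {x, y} (by simp)
    simp only [Set.mem_insert_iff, Set.mem_singleton_iff, not_or] at hux
    by_contra hqy
    refine gI_notMem_gPhi hq hqx (h u ((gIsU_iff u).2 hu) hux.1 hux.2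
      (gI_mem_gPhi hq (Ne.symm hux.2) hqy ?_))
    exact fun h => hq.not_isUnit (isUnit_of_dvd_unit h hu)
  · intro h u hu hux huy S hS
    rw [gIsU_iff] at hu
    rw [mem_gPhi] at hS ⊢
    obtain ⟨b, c, ⟨hb, hxb⟩, ⟨hc, hyc⟩, hsub⟩ := hS
    have hne : u.1 - x.1 ≠ 0 := fun e => hux (Subtype.ext (sub_eq_zero.1 e))
    set k := (u.1 - x.1).natDegree + 1 with hk
    have hcop : IsCoprime x.1 b := by
      refine isCoprime_of_prime_dvd (fun e => hb e.2) ?_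
      intro q hq hqx hqb
      exact not_dvd_of_coprime hq hxb (h q hq hqx) hqb
    refine ⟨b ^ k, c * b ^ k, ⟨pow_ne_zero _ hb, hcop.pow_right⟩,
      ⟨mul_ne_zero hc (pow_ne_zero _ hb), gcop_of_isUnit hu _⟩, fun z hz => hsub ⟨?_, ?_⟩⟩
    · rw [← mul_one b]
      refine mem_closure_gCo (by simpa using hb) (fun q hq hqb => ?_) (one_dvd _)
      by_contra hqz
      have h1 := dvd_of_mem_closure_gCo hq k hz.1 hqz (pow_dvd_pow_of_dvd hqb k)
      have h2 := dvd_of_mem_closure_gCo hq k hz.2 hqz ((pow_dvd_pow_of_dvd hqb k).mul_left c)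
      have h3 := dvd_sub h1 h2
      rw [show z.1 - x.1 - (z.1 - u.1) = u.1 - x.1 by ring] at h3
      have h4 := natDegree_le_of_dvd h3 hne
      rw [natDegree_pow] at h4
      have h5 : 0 < q.natDegree := hq.irreducible.natDegree_pos
      nlinarith
    · refine closure_mono ?_ hz.2
      intro w hw
      exact (dvd_mul_right c _).trans hw

theorem mem_gPP_iff [Infinite K] (S : Set (GolombSpace K[X])) :
    S ∈ gPP (GolombSpace K[X]) ↔ ∃ q : K[X], Prime q ∧ S = gI q := by
  have hle : ∀ (q : K[X]) (hq : Prime q) (y : GolombSpace K[X]),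
      gLe ⟨q, hq.ne_zero⟩ y ↔ q ∣ y.1 := by
    intro q hq y
    rw [gLe_iff]
    constructor
    · intro h
      exact h q hq dvd_rfl
    · intro h r _ hrq
      exact hrq.trans h
  constructor
  · rintro ⟨x, hx, hmin, rfl⟩
    rw [gIsU_iff] at hx
    obtain ⟨q, hq, hqx⟩ := WfDvdMonoid.exists_irreducible_factor hx x.2
    have hq := hq.prime
    have h1 := hmin ⟨q, hq.ne_zero⟩ (by rw [gIsU_iff]; exact hq.not_isUnit) ((hle q hq x).2 hqx)
    rw [gLe_iff] at h1
    refine ⟨q, hq, ?_⟩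
    ext y
    simp only [Set.mem_ofPred_eq, mem_gI, gLe_iff]
    constructor
    · intro h
      exact h q hq hqx
    · intro h r hr hrx
      exact (h1 r hr hrx).trans h
  · rintro ⟨q, hq, rfl⟩
    refine ⟨⟨q, hq.ne_zero⟩, by rw [gIsU_iff]; exact hq.not_isUnit, ?_, ?_⟩
    · intro y hy hyq
      rw [gIsU_iff] at hy
      rw [hle q hq]
      rw [gLe_iff] at hyq
      obtain ⟨r, hr, hry⟩ := WfDvdMonoid.exists_irreducible_factor hy y.2
      have h1 : r ∣ q := hyq r hr.prime hry
      exact ((hr.prime.irreducible.associated_of_dvd hq.irreducible h1).symm.dvd).trans hry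
    · ext y
      simp only [Set.mem_ofPred_eq, mem_gI, hle q hq]

theorem gFF_clopen {q : K[X]} (hq : Prime q) {u : GolombSpace K[X]} (hu : ¬ q ∣ u.1)
    {W : Set (GolombSpace K[X])} (hW : W ⊆ (gI q)ᶜ) (hWo : IsOpen W)
    (hWc : IsOpen ((gI q)ᶜ \ W)) (huW : u ∈ W) : ∃ n : ℕ, gCo u.1 (q ^ (n + 1)) ⊆ W := by
  obtain ⟨b, ⟨hb, hub⟩, hbW⟩ := exists_gCo hWo u huW
  obtain ⟨n, c, rfl, hqc⟩ := split_pow hq hb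
  refine ⟨n, fun w hw => ?_⟩
  by_contra hwW
  have hqw : ¬ q ∣ w.1 := by
    intro h
    apply hu
    have := dvd_sub h ((dvd_pow_self q (Nat.succ_ne_zero n)).trans (mem_gCo.1 hw))
    rwa [sub_sub_cancel] at this
  obtain ⟨b', ⟨hb', hwb'⟩, hbW'⟩ := exists_gCo hWc w ⟨hqw, hwW⟩
  obtain ⟨n', c', rfl, hqc'⟩ := split_pow hq hb'
  have hcc : ¬ q ∣ c * c' := fun h => (hq.dvd_or_dvd h).elim hqc hqc'
  obtain ⟨s, t, hst⟩ := coprime_of_not_dvd hq hcc (n + n' + 1)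
  have hyw : q ^ (n + n' + 1) ∣ w.1 * s * (c * c') - w.1 :=
    ⟨- w.1 * t, by linear_combination w.1 * hst⟩
  have hqy : ¬ q ∣ w.1 * s * (c * c') := by
    intro h
    apply hqw
    have := dvd_sub h ((dvd_pow_self q (Nat.succ_ne_zero _)).trans hyw)
    rwa [sub_sub_cancel] at this
  have hy0 : w.1 * s * (c * c') ≠ 0 := fun h => hqy (by rw [h]; exact dvd_zero q)
  set y : GolombSpace K[X] := ⟨_, hy0⟩ with hy
  have hyu : q ^ n ∣ y.1 - u.1 := by
    have h1 : q ^ n ∣ y.1 - w.1 := (pow_dvd_pow q (by omega)).trans hyw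
    have h2 : q ^ n ∣ w.1 - u.1 := (pow_dvd_pow q (by omega)).trans (mem_gCo.1 hw)
    have := dvd_add h1 h2
    rwa [sub_add_sub_cancel] at this
  have hc1 : y ∈ closure (gCo u.1 (q ^ n * c)) := by
    rw [mul_comm]
    refine mem_closure_gCo (by rwa [mul_comm]) (fun r _ hr => ?_) hyu
    exact (hr.mul_right _).mul_left _
  have hc2 : y ∈ closure (gCo w.1 (q ^ n' * c')) := by
    rw [mul_comm]
    refine mem_closure_gCo (by rwa [mul_comm]) (fun r _ hr => ?_)
      ((pow_dvd_pow q (by omega)).trans hyw)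
    exact (hr.mul_left _).mul_left _
  by_cases hyW : y ∈ W
  · obtain ⟨z, hz1, hz2⟩ := mem_closure_iff.1 hc2 W hWo hyW
    exact (hbW' hz2).2 hz1
  · obtain ⟨z, hz1, hz2⟩ := mem_closure_iff.1 hc1 _ hWc ⟨hqy, hyW⟩
    exact hz1.2 (hbW hz2)

theorem gFF_eq {q : K[X]} (hq : Prime q) {u : GolombSpace K[X]} (hu : ¬ q ∣ u.1) :
    gFF u (gI q) = ⨅ n : ℕ, 𝓟 (gCo u.1 (q ^ (n + 1))) := by
  apply le_antisymm
  · refine le_iInf fun n => ?_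
    refine iInf₂_le (gCo u.1 (q ^ (n + 1))) ?_
    have hnot : ∀ w ∈ gCo u.1 (q ^ (n + 1)), ¬ q ∣ w.1 := by
      intro w hw h
      apply hu
      have := dvd_sub h ((dvd_pow_self q (Nat.succ_ne_zero n)).trans (mem_gCo.1 hw))
      rwa [sub_sub_cancel] at this
    refine ⟨hnot, ?_, ?_, ?_⟩
    · exact isOpen_gCo u.2 (pow_ne_zero _ hq.ne_zero) (coprime_of_not_dvd hq hu _)
    · rw [isOpen_iff_forall_mem_open]
      rintro w ⟨hw1, hw2⟩
      refine ⟨gCo w.1 (q ^ (n + 1)), ?_, ?_, ?_⟩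
      · intro y hy
        refine ⟨fun h => hw1 ?_, fun h => hw2 ?_⟩
        · have := dvd_sub (mem_gI.1 h)
            ((dvd_pow_self q (Nat.succ_ne_zero n)).trans (mem_gCo.1 hy))
          rwa [sub_sub_cancel] at this
        · have := dvd_sub (mem_gCo.1 h) (mem_gCo.1 hy)
          rwa [show y.1 - u.1 - (y.1 - w.1) = w.1 - u.1 by ring] at this
      · exact isOpen_gCo w.2 (pow_ne_zero _ hq.ne_zero) (coprime_of_not_dvd hq hw1 _)
      · simp [mem_gCo]
    · simp [mem_gCo]
  · refine le_iInf₂ fun W hW => ?_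
    obtain ⟨n, hn⟩ := gFF_clopen hq hu hW.1 hW.2.1 hW.2.2.1 hW.2.2.2
    exact iInf_le_of_le n (principal_mono.2 hn)

theorem mem_gFF {q : K[X]} (hq : Prime q) {u : GolombSpace K[X]} (hu : ¬ q ∣ u.1)
    {S : Set (GolombSpace K[X])} :
    S ∈ gFF u (gI q) ↔ ∃ n : ℕ, gCo u.1 (q ^ (n + 1)) ⊆ S := by
  rw [gFF_eq hq hu, mem_iInf_of_directed]
  · simp
  · refine Antitone.directed_ge ?_
    intro m n hmn
    refine principal_mono.2 fun z hz => ?_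
    exact (pow_dvd_pow q (by omega)).trans hz

end GolombPoly

section GolombSep
open Topology

theorem gsep_infinite (K : Type*) [Field K] [IsSepClosed K] : Infinite K := by
  by_contra h
  rw [not_infinite_iff_finite] at h
  have : IsAlgClosed K := inferInstance
  exact not_finite K

section alg
variable {L : Type*} [Field L]

theorem gsq_dvd {α β w v : L} {m : ℕ} (hw : w ≠ 0) (hαβ : β ≠ α)
    (h : (X - C β) ^ 2 ∣ C w * (X - C α) ^ m - C v) : (m : L) = 0 := by
  obtain ⟨H, hH⟩ := h
  have h1 := congrArg (fun f => eval β (derivative f)) hH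
  simp [derivative_pow] at h1
  have h2 : β - α ≠ 0 := sub_ne_zero.2 hαβ
  rcases h1 with h1 | h1 | h1
  · exact absurd h1 hw
  · exact h1
  · exact absurd h1.1 h2

variable [IsAlgClosed L] {p : ℕ} [hp : Fact p.Prime] [CharP L p]

theorem gpow_inj {x y : L} (s : ℕ) (h : x ^ p ^ s = y ^ p ^ s) : x = y := by
  have : ExpChar L p := ExpChar.prime hp.out
  exact iterateFrobenius_inj L p s (by simpa [iterateFrobenius_def] using h)

theorem gpow_form (α w v : L) (s m : ℕ) : ∃ w₁ v₁ : L, w₁ ^ p ^ s = w ∧ v₁ ^ p ^ s = v ∧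
    C w * (X - C α) ^ (p ^ s * m) - C v = (C w₁ * (X - C α) ^ m - C v₁) ^ p ^ s := by
  have hpos : 0 < p ^ s := pow_pos hp.out.pos s
  obtain ⟨w₁, hw₁⟩ := IsAlgClosed.exists_pow_nat_eq w hpos
  obtain ⟨v₁, hv₁⟩ := IsAlgClosed.exists_pow_nat_eq v hpos
  refine ⟨w₁, v₁, hw₁, hv₁, ?_⟩
  rw [sub_pow_char_pow, mul_pow, ← C_pow, ← C_pow, hw₁, hv₁, ← pow_mul, mul_comm m]

theorem gclaim_one {α β w v : L} {n s j : ℕ} (hn : n ≤ p ^ s) (hj : p ^ s ∣ j)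
    (h : w * (β - α) ^ j = v) : (X - C β) ^ n ∣ C w * (X - C α) ^ j - C v := by
  obtain ⟨m, rfl⟩ := hj
  obtain ⟨w₁, v₁, hw, hv, e⟩ := gpow_form (p := p) α w v s m
  rw [e]
  refine (pow_dvd_pow _ hn).trans (pow_dvd_pow_of_dvd ?_ _)
  rw [dvd_iff_isRoot]
  have : w₁ * (β - α) ^ m = v₁ := by
    apply gpow_inj (p := p) s
    rw [mul_pow, hw, hv, ← h, ← pow_mul, mul_comm m]
  simp [this]

theorem gclaim_two {α β w v : L} {j : ℕ} (hw : w ≠ 0) (hαβ : β ≠ α) (s : ℕ)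
    (h : (X - C β) ^ p ^ s ∣ C w * (X - C α) ^ j - C v) : p ^ s ∣ j := by
  induction s with
  | zero => simp
  | succ s ih =>
    obtain ⟨m, rfl⟩ := ih ((pow_dvd_pow _ (Nat.pow_le_pow_right hp.out.pos (by omega))).trans h)
    obtain ⟨w₁, v₁, hw₁, hv₁, e⟩ := gpow_form (p := p) α w v s m
    have hpos : p ^ s ≠ 0 := (pow_pos hp.out.pos s).ne'
    rw [e, pow_succ', pow_mul, IsIntegrallyClosed.pow_dvd_pow_iff hpos] at h
    have h2 := (pow_dvd_pow (X - C β) hp.out.two_le).trans h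
    have hw1 : w₁ ≠ 0 := by
      rintro rfl
      rw [zero_pow hpos] at hw₁
      exact hw hw₁.symm
    have h3 := gsq_dvd hw1 hαβ h2
    rw [CharP.cast_eq_zero_iff L p] at h3
    rw [pow_succ]
    exact mul_dvd_mul_left _ h3

end alg

variable {K : Type*} [Field K] [IsSepClosed K]


/-- Nonzero polynomials vanishing at `β`. -/
def gJ (β : AlgebraicClosure K) : Set (GolombSpace K[X]) := {z | aeval β z.1 = 0}

theorem mem_gJ {β : (AlgebraicClosure K)} {z : GolombSpace K[X]} : z ∈ gJ β ↔ aeval β z.1 = 0 := Iff.rfl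

theorem gminpoly_prime (β : (AlgebraicClosure K)) : Prime (minpoly K β) :=
  minpoly.prime (Algebra.IsIntegral.isIntegral β)

theorem gJ_eq (β : (AlgebraicClosure K)) : gJ β = gI (minpoly K β) := by
  ext z
  rw [mem_gJ, mem_gI, minpoly.dvd_iff]

theorem gPP_eq : gPP (GolombSpace K[X]) = Set.range (gJ (K := K)) := by
  have := gsep_infinite K
  ext S
  rw [mem_gPP_iff]
  constructor
  · rintro ⟨q, hq, rfl⟩
    obtain ⟨β, hβ⟩ := IsAlgClosed.exists_aeval_eq_zero (AlgebraicClosure K) q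
      (degree_pos_of_irreducible hq.irreducible).ne'
    refine ⟨β, ?_⟩
    rw [gJ_eq]
    have h1 : minpoly K β ∣ q := minpoly.dvd K β hβ
    have h2 := (gminpoly_prime β).irreducible.associated_of_dvd hq.irreducible h1
    ext z
    rw [mem_gI, mem_gI, h2.dvd_iff_dvd_left]
  · rintro ⟨β, rfl⟩
    exact ⟨_, gminpoly_prime β, gJ_eq β⟩

theorem gJ_injective : Function.Injective (gJ (K := K)) := by
  intro β β' h
  obtain ⟨q, hq⟩ := ExpChar.exists K
  have hqL : ExpChar (AlgebraicClosure K) q := expChar_of_injective_algebraMap (algebraMap K (AlgebraicClosure K)).injective q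
  obtain ⟨n, c, hc⟩ := IsPurelyInseparable.pow_mem K q β
  have hpos : 0 < q ^ n := pow_pos (expChar_pos K q) n
  have hz : (X ^ q ^ n - C c : K[X]) ≠ 0 := X_pow_sub_C_ne_zero hpos c
  have h1 : (⟨_, hz⟩ : GolombSpace K[X]) ∈ gJ β := by
    simp [mem_gJ, hc]
  rw [h] at h1
  simp [mem_gJ, hc] at h1
  exact iterateFrobenius_inj (AlgebraicClosure K) q n (by
    simpa [iterateFrobenius_def] using (sub_eq_zero.1 h1).symm)

/-- `β`-adic neighbourhoods. -/
def gB (u : K) (β : AlgebraicClosure K) (n : ℕ) : Set (GolombSpace K[X]) :=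
  {z | (X - C β) ^ n ∣ z.1.map (algebraMap K (AlgebraicClosure K)) - C (algebraMap K (AlgebraicClosure K) u)}

theorem mem_gFF_gJ {u : GolombSpace K[X]} {v : K} (hv : v ≠ 0) (hu : u.1 = C v) (β : (AlgebraicClosure K))
    {S : Set (GolombSpace K[X])} :
    S ∈ gFF u (gJ β) ↔ ∃ n : ℕ, gB v β n ⊆ S := by
  have hq := gminpoly_prime β
  rw [gJ_eq, mem_gFF hq]
  · have e : ∀ z : GolombSpace K[X], z.1.map (algebraMap K (AlgebraicClosure K)) - C (algebraMap K (AlgebraicClosure K) v) =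
        (z.1 - u.1).map (algebraMap K (AlgebraicClosure K)) := by
      intro z
      rw [hu, Polynomial.map_sub, map_C]
    obtain ⟨q, hqK⟩ := ExpChar.exists K
    obtain ⟨M, hM⟩ := IsPurelyInseparable.minpoly_eq_X_sub_C_pow K q β
    constructor
    · rintro ⟨n, hn⟩
      refine ⟨q ^ M * (n + 1), fun z hz => hn ?_⟩
      have hz : (X - C β) ^ (q ^ M * (n + 1)) ∣ _ := hz
      rw [e, pow_mul, ← hM, ← Polynomial.map_pow, map_dvd_map'] at hz
      exact hz
    · rintro ⟨n, hn⟩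
      refine ⟨n, fun z hz => hn ?_⟩
      have hz := mem_gCo.1 hz
      rw [← map_dvd_map' (algebraMap K (AlgebraicClosure K)), Polynomial.map_pow] at hz
      change (X - C β) ^ n ∣ _
      rw [e]
      refine (pow_dvd_pow _ (Nat.le_succ n)).trans ((pow_dvd_pow_of_dvd ?_ _).trans hz)
      rw [dvd_iff_isRoot, IsRoot.def, eval_map_algebraMap, minpoly.aeval]
  · rw [minpoly.dvd_iff, hu]
    simpa using hv

theorem gAA_form {α : (AlgebraicClosure K)} {z : GolombSpace K[X]} (hz : z ∈ gAA (gJ α)) :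
    ∃ (w : (AlgebraicClosure K)) (j : ℕ), w ≠ 0 ∧ 1 ≤ j ∧
      z.1.map (algebraMap K (AlgebraicClosure K)) = C w * (X - C α) ^ j := by
  have hne : z.1.map (algebraMap K (AlgebraicClosure K)) ≠ 0 := Polynomial.map_ne_zero z.2
  have hroot : ∀ β ∈ (z.1.map (algebraMap K (AlgebraicClosure K))).roots, β = α := by
    intro β hβ
    rw [mem_roots hne, IsRoot.def, eval_map_algebraMap] at hβ
    exact gJ_injective (hz.2 (gJ β) (by rw [gPP_eq]; exact ⟨β, rfl⟩) hβ)
  have hrep := Multiset.eq_replicate_card.2 hroot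
  have hs := (IsAlgClosed.splits (z.1.map (algebraMap K (AlgebraicClosure K)))).eq_prod_roots
  refine ⟨(z.1.map (algebraMap K (AlgebraicClosure K))).leadingCoeff, (z.1.map (algebraMap K (AlgebraicClosure K))).roots.card,
    leadingCoeff_ne_zero.2 hne, ?_, ?_⟩
  · rw [Nat.one_le_iff_ne_zero, Ne, Multiset.card_eq_zero]
    intro h0
    have : α ∈ (z.1.map (algebraMap K (AlgebraicClosure K))).roots := by
      rw [mem_roots hne, IsRoot.def, eval_map_algebraMap]
      exact hz.1
    rw [h0] at this
    simp at this
  · conv_lhs => rw [hs, hrep]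
    simp

theorem mem_gAA {α w : (AlgebraicClosure K)} {j : ℕ} {z : GolombSpace K[X]} (hj : 1 ≤ j)
    (h : z.1.map (algebraMap K (AlgebraicClosure K)) = C w * (X - C α) ^ j) : z ∈ gAA (gJ α) := by
  have hne : z.1.map (algebraMap K (AlgebraicClosure K)) ≠ 0 := Polynomial.map_ne_zero z.2
  have hw : w ≠ 0 := by
    rintro rfl
    simp at h
    exact z.2 h
  have key : ∀ β, aeval β z.1 = 0 ↔ β = α := by
    intro β
    rw [← eval_map_algebraMap, h]
    simp [hw, sub_eq_zero]
    omega
  refine ⟨(key α).2 rfl, ?_⟩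
  rw [gPP_eq]
  rintro _ ⟨β, rfl⟩ hβ
  rw [(key β).1 hβ]

theorem gdvd_eval {α β w v : (AlgebraicClosure K)} {j n : ℕ} (hn : 1 ≤ n)
    (h : (X - C β) ^ n ∣ C w * (X - C α) ^ j - C v) : w * (β - α) ^ j = v := by
  have h1 := (dvd_pow_self (X - C β) (by omega)).trans h
  rw [dvd_iff_isRoot] at h1
  simpa [sub_eq_zero] using h1

theorem gPP_infinite : (gPP (GolombSpace K[X])).Infinite := by
  rw [gPP_eq]
  exact Set.infinite_range_of_injective gJ_injective

theorem gncard_zero {u : GolombSpace K[X]} {v : K} (hv : v ≠ 0) (hu : u.1 = C v) (α β δ : (AlgebraicClosure K))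
    (n : ℕ) (h : ∀ z ∈ gAA (gJ α), z ∈ gB v β n → z ∈ gB v δ n → False) :
    (gQQ u (gJ α) (gJ β) (gJ δ)).ncard = 0 := by
  have hbot : gFF u (gJ β) ⊓ gFF u (gJ δ) ⊓ 𝓟 (gAA (gJ α)) = ⊥ := by
    rw [← Filter.empty_mem_iff_bot]
    refine mem_of_superset (inter_mem_inf (inter_mem_inf
      ((mem_gFF_gJ hv hu β).2 ⟨n, subset_rfl⟩) ((mem_gFF_gJ hv hu δ).2 ⟨n, subset_rfl⟩))
      (mem_principal_self _)) ?_
    rintro z ⟨⟨h1, h2⟩, h3⟩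
    exact h z h3 h1 h2
  apply Set.Infinite.ncard
  have : gQQ u (gJ α) (gJ β) (gJ δ) = gPP (GolombSpace K[X]) := by
    ext S
    unfold gQQ
    rw [hbot]
    simp
  rw [this]
  exact gPP_infinite

theorem gB_iff {v : K} {α β w : (AlgebraicClosure K)} {n j : ℕ} {z : GolombSpace K[X]}
    (h : z.1.map (algebraMap K (AlgebraicClosure K)) = C w * (X - C α) ^ j) :
    z ∈ gB v β n ↔ (X - C β) ^ n ∣ C w * (X - C α) ^ j - C (algebraMap K (AlgebraicClosure K) v) := by
  rw [← h]
  rfl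

theorem gU_form {u : GolombSpace K[X]} (hu : gIsU u) : ∃ v : K, v ≠ 0 ∧ u.1 = C v := by
  have := gsep_infinite K
  rw [gIsU_iff] at hu
  obtain ⟨v, hv, e⟩ := Polynomial.isUnit_iff.1 hu
  exact ⟨v, hv.ne_zero, e.symm⟩

theorem gncard_side {u : GolombSpace K[X]} {v : K} (hv : v ≠ 0) (hu : u.1 = C v) (α β δ : (AlgebraicClosure K))
    (h : β = α ∨ δ = α) : (gQQ u (gJ α) (gJ β) (gJ δ)).ncard = 0 := by
  have key : ∀ z ∈ gAA (gJ α), ¬ z ∈ gB v α 1 := by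
    intro z hz h1
    obtain ⟨w, j, hw, hj, e⟩ := gAA_form hz
    rw [gB_iff e] at h1
    have h2 := gdvd_eval le_rfl h1
    rw [sub_self, zero_pow (by omega), mul_zero] at h2
    exact hv (by simpa using h2.symm)
  refine gncard_zero hv hu α β δ 1 (fun z hz h1 h2 => ?_)
  rcases h with rfl | rfl
  · exact key z hz h1
  · exact key z hz h2

theorem gAch_zero [CharZero K] : gAch (GolombSpace K[X]) ⊆ {0} := by
  rintro N ⟨u, hU, A, hA, P, hP, Q, hQ, rfl⟩
  rw [gPP_eq] at hA hP hQ
  obtain ⟨α, rfl⟩ := hA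
  obtain ⟨β, rfl⟩ := hP
  obtain ⟨δ, rfl⟩ := hQ
  obtain ⟨v, hv, hu⟩ := gU_form hU
  rw [Set.mem_singleton_iff]
  by_cases hβ : β = α
  · exact gncard_side hv hu α β δ (Or.inl hβ)
  refine gncard_zero hv hu α β δ 2 (fun z hz h1 _ => ?_)
  obtain ⟨w, j, hw, hj, e⟩ := gAA_form hz
  rw [gB_iff e] at h1
  have := gsq_dvd hw hβ h1
  rw [Nat.cast_eq_zero] at this
  omega


theorem gpow_mem_large {p : ℕ} [hp : Fact p.Prime] [CharP K p] (x : (AlgebraicClosure K)) : ∃ s₀ : ℕ, ∀ s ≥ s₀, ∃ c : K, algebraMap K (AlgebraicClosure K) c = x ^ p ^ s := by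
  have : ExpChar K p := ExpChar.prime hp.out
  obtain ⟨n, c, hc⟩ := IsPurelyInseparable.pow_mem K p x
  refine ⟨n, fun s hs => ⟨c ^ p ^ (s - n), ?_⟩⟩
  rw [map_pow, hc, ← pow_mul, ← pow_add, Nat.add_sub_cancel' hs]

theorem gexists_elem {p : ℕ} [hp : Fact p.Prime] [CharP K p] {v : K} (hv : v ≠ 0) {α β : (AlgebraicClosure K)} (hαβ : β ≠ α) {N : ℕ} (hN : 0 < N) (s₁ : ℕ) :
    ∃ (s : ℕ) (w : (AlgebraicClosure K)) (z : GolombSpace K[X]), s₁ ≤ s ∧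
      z.1.map (algebraMap K (AlgebraicClosure K)) = C w * (X - C α) ^ (N * p ^ s) ∧
      w * (β - α) ^ (N * p ^ s) = algebraMap K (AlgebraicClosure K) v := by
  obtain ⟨s₂, h₂⟩ := gpow_mem_large (p := p) α
  obtain ⟨s₃, h₃⟩ := gpow_mem_large (p := p) (β - α)
  set s := max s₁ (max s₂ s₃) with hs
  obtain ⟨a, ha⟩ := h₂ s (by omega)
  obtain ⟨c, hc⟩ := h₃ s (by omega)
  have hc0 : c ≠ 0 := by
    rintro rfl
    rw [map_zero] at hc
    exact pow_ne_zero _ (sub_ne_zero.2 hαβ) hc.symm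
  have hpos : 0 < p ^ s := pow_pos hp.out.pos s
  have hz : C (v / c ^ N) * (X ^ p ^ s - C a) ^ N ≠ 0 :=
    mul_ne_zero (C_ne_zero.2 (div_ne_zero hv (pow_ne_zero _ hc0)))
      (pow_ne_zero _ (X_pow_sub_C_ne_zero hpos a))
  refine ⟨s, algebraMap K (AlgebraicClosure K) (v / c ^ N), ⟨_, hz⟩, by omega, ?_, ?_⟩
  · have e : (X - C α) ^ p ^ s = X ^ p ^ s - C (algebraMap K (AlgebraicClosure K) a) := by
      rw [sub_pow_char_pow, ← C_pow, ha]
    rw [mul_comm N, pow_mul, e]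
    simp
  · rw [mul_comm N, pow_mul, ← hc, ← map_pow, ← map_mul, div_mul_cancel₀ _ (pow_ne_zero _ hc0)]

theorem gQQ_eq {p : ℕ} [hp : Fact p.Prime] [CharP K p] {u : GolombSpace K[X]} {v : K} (hv : v ≠ 0) (hu : u.1 = C v) {α β δ : (AlgebraicClosure K)}
    (hβ : β ≠ α) (hδ : δ ≠ α) {N : ℕ} (hN : 0 < N)
    (hord : orderOf ((δ - α) / (β - α)) = N) :
    gQQ u (gJ α) (gJ β) (gJ δ) = (fun ξ : (AlgebraicClosure K) => gJ (α + ξ * (β - α))) '' {ξ | ξ ^ N = 1} := by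
  have hβ' : β - α ≠ 0 := sub_ne_zero.2 hβ
  have hδ' : δ - α ≠ 0 := sub_ne_zero.2 hδ
  have hv' : algebraMap K (AlgebraicClosure K) v ≠ 0 := by simpa using hv
  ext S
  constructor
  · rintro ⟨hS, hle⟩
    rw [gPP_eq] at hS
    obtain ⟨ε, rfl⟩ := hS
    have h1 : gB v ε 1 ∈ gFF u (gJ ε) := (mem_gFF_gJ hv hu ε).2 ⟨1, subset_rfl⟩
    have h2 := hle h1
    rw [mem_inf_principal, mem_inf_iff_superset] at h2
    obtain ⟨t₁, ht₁, t₂, ht₂, hsub⟩ := h2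
    obtain ⟨n₁, hn₁⟩ := (mem_gFF_gJ hv hu β).1 ht₁
    obtain ⟨n₂, hn₂⟩ := (mem_gFF_gJ hv hu δ).1 ht₂
    obtain ⟨s, w, z, hs, e, hw⟩ := gexists_elem (p := p) hv hβ hN (n₁ + n₂)
    have hlt : s < p ^ s := Nat.lt_pow_self hp.out.one_lt
    have hj : 1 ≤ N * p ^ s := Nat.mul_pos hN (pow_pos hp.out.pos s)
    have hw2 : w * (δ - α) ^ (N * p ^ s) = algebraMap K (AlgebraicClosure K) v := by
      have : (δ - α) = (δ - α) / (β - α) * (β - α) := by field_simp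
      rw [this, mul_pow, pow_mul ((δ - α) / (β - α)), ← hord, pow_orderOf_eq_one, one_pow, one_mul,
        hord, hw]
    have hz1 : z ∈ gB v β n₁ := (gB_iff e).2
      (gclaim_one (p := p) (s := s) (by omega) (dvd_mul_left _ _) hw)
    have hz2 : z ∈ gB v δ n₂ := (gB_iff e).2
      (gclaim_one (p := p) (s := s) (by omega) (dvd_mul_left _ _) hw2)
    have hz := hsub ⟨hn₁ hz1, hn₂ hz2⟩ (mem_gAA hj e)
    have hw3 := gdvd_eval le_rfl ((gB_iff e).1 hz)
    have hw0 : w ≠ 0 := by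
      rintro rfl
      rw [zero_mul] at hw
      exact hv' hw.symm
    refine ⟨(ε - α) / (β - α), ?_, ?_⟩
    · change ((ε - α) / (β - α)) ^ N = 1
      apply gpow_inj (p := p) s
      rw [one_pow, ← pow_mul, div_pow, div_eq_one_iff_eq (pow_ne_zero _ hβ')]
      exact mul_left_cancel₀ hw0 (hw3.trans hw.symm)
    · change gJ _ = gJ _
      congr 1
      field_simp
      ring
  · rintro ⟨ξ, hξ, rfl⟩
    have hξ : ξ ^ N = 1 := hξ
    refine ⟨by rw [gPP_eq]; exact ⟨_, rfl⟩, fun S hS => ?_⟩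
    obtain ⟨n, hn⟩ := (mem_gFF_gJ hv hu _).1 hS
    refine mem_of_superset (inter_mem_inf (inter_mem_inf
      ((mem_gFF_gJ hv hu β).2 ⟨p ^ n, subset_rfl⟩) ((mem_gFF_gJ hv hu δ).2 ⟨1, subset_rfl⟩))
      (mem_principal_self _)) ?_
    rintro z ⟨⟨h1, h2⟩, h3⟩
    apply hn
    obtain ⟨w, j, hw, hj, e⟩ := gAA_form h3
    rw [gB_iff e] at h1 h2 ⊢
    have hpj := gclaim_two (p := p) hw hβ n h1
    have e1 := gdvd_eval (Nat.one_le_iff_ne_zero.2 (pow_pos hp.out.pos n).ne') h1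
    have e2 := gdvd_eval le_rfl h2
    have hNj : N ∣ j := by
      rw [← hord, orderOf_dvd_iff_pow_eq_one, div_pow, div_eq_one_iff_eq (pow_ne_zero _ hβ')]
      exact mul_left_cancel₀ hw (e2.trans e1.symm)
    refine gclaim_one (p := p) (s := n) (Nat.lt_pow_self hp.out.one_lt).le hpj ?_
    rw [add_sub_cancel_left, mul_pow]
    obtain ⟨d, rfl⟩ := hNj
    rw [pow_mul ξ, hξ, one_pow, one_mul, e1]

theorem gncard_eq {p : ℕ} [hp : Fact p.Prime] [CharP K p] {u : GolombSpace K[X]} {v : K} (hv : v ≠ 0) (hu : u.1 = C v) {α β δ : (AlgebraicClosure K)}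
    (hβ : β ≠ α) (hδ : δ ≠ α) {N : ℕ} (hN : 0 < N)
    (hord : orderOf ((δ - α) / (β - α)) = N) :
    (gQQ u (gJ α) (gJ β) (gJ δ)).ncard = N := by
  have hβ' : β - α ≠ 0 := sub_ne_zero.2 hβ
  rw [gQQ_eq (p := p) hv hu hβ hδ hN hord, Set.ncard_image_of_injective]
  · have hprim := IsPrimitiveRoot.orderOf ((δ - α) / (β - α))
    rw [hord] at hprim
    have hset : {ξ : (AlgebraicClosure K) | ξ ^ N = 1} = (nthRootsFinset N (1 : (AlgebraicClosure K)) : Set (AlgebraicClosure K)) := by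
      ext ξ
      simp [mem_nthRootsFinset hN]
    rw [hset, Set.ncard_coe_finset, hprim.card_nthRootsFinset]
  · intro ξ ξ' h
    have := gJ_injective h
    exact mul_right_cancel₀ hβ' (add_left_cancel this)

theorem gAch_not_dvd {p : ℕ} [hp : Fact p.Prime] [CharP K p] {N : ℕ} (h : N ∈ gAch (GolombSpace K[X])) (hN : N ≠ 0) : ¬ p ∣ N := by
  obtain ⟨u, hU, A, hA, P, hP, Q, hQ, rfl⟩ := h
  rw [gPP_eq] at hA hP hQ
  obtain ⟨α, rfl⟩ := hA
  obtain ⟨β, rfl⟩ := hP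
  obtain ⟨δ, rfl⟩ := hQ
  obtain ⟨v, hv, hu⟩ := gU_form hU
  have hβ : β ≠ α := fun e => hN (gncard_side hv hu α β δ (Or.inl e))
  have hδ : δ ≠ α := fun e => hN (gncard_side hv hu α β δ (Or.inr e))
  have hβ' : β - α ≠ 0 := sub_ne_zero.2 hβ
  have hfin : 0 < orderOf ((δ - α) / (β - α)) := by
    by_contra h0
    apply hN
    refine gncard_zero hv hu α β δ 1 (fun z hz h1 h2 => h0 ?_)
    obtain ⟨w, j, hw, hj, e⟩ := gAA_form hz
    rw [gB_iff e] at h1 h2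
    have e1 := gdvd_eval le_rfl h1
    have e2 := gdvd_eval le_rfl h2
    rw [orderOf_pos_iff, isOfFinOrder_iff_pow_eq_one]
    refine ⟨j, hj, ?_⟩
    rw [div_pow, div_eq_one_iff_eq (pow_ne_zero _ hβ')]
    exact mul_left_cancel₀ hw (e2.trans e1.symm)
  rw [gncard_eq (p := p) hv hu hβ hδ hfin rfl]
  rintro ⟨d, hd⟩
  have hd0 : 0 < d := by
    rcases Nat.eq_zero_or_pos d with rfl | h
    · omega
    · exact h
  have h1 : ((δ - α) / (β - α)) ^ d = 1 := by
    apply gpow_inj (p := p) 1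
    rw [one_pow, pow_one, ← pow_mul, mul_comm d, ← hd, pow_orderOf_eq_one]
  have h2 := Nat.le_of_dvd hd0 (orderOf_dvd_of_pow_eq_one h1)
  have := hp.out.two_le
  nlinarith

theorem gAch_mem {p : ℕ} [hp : Fact p.Prime] [CharP K p] {N : ℕ} (hN : 0 < N) (h : ¬ p ∣ N) : N ∈ gAch (GolombSpace K[X]) := by
  have := gsep_infinite K
  have hNL : NeZero (N : (AlgebraicClosure K)) := ⟨by rwa [Ne, CharP.cast_eq_zero_iff (AlgebraicClosure K) p]⟩
  obtain ⟨ζ, hζ⟩ := HasEnoughRootsOfUnity.exists_primitiveRoot (AlgebraicClosure K) N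
  have hζ0 : ζ ≠ 0 := hζ.ne_zero hN.ne'
  refine ⟨⟨C 1, by simp⟩, by rw [gIsU_iff]; simp, gJ 0, by rw [gPP_eq]; exact ⟨_, rfl⟩,
    gJ 1, by rw [gPP_eq]; exact ⟨_, rfl⟩, gJ ζ, by rw [gPP_eq]; exact ⟨_, rfl⟩, ?_⟩
  exact gncard_eq (p := p) (v := 1) one_ne_zero rfl one_ne_zero hζ0 hN
    (by simpa using hζ.eq_orderOf.symm)

end GolombSep

theorem gchar_aux (K : Type*) [Field K] [IsSepClosed K]
    (K' : Type*) [Field K'] [IsSepClosed K'] (p p' : ℕ) [CharP K p] [CharP K' p']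
    (h : GolombSpace (Polynomial K) ≃ₜ GolombSpace (Polynomial K')) (hp : p ≠ 0) :
    p = p' := by
  have hp1 : Fact p.Prime := ⟨(CharP.char_is_prime_or_zero K p).resolve_right hp⟩
  have h1 : 1 ∈ gAch (GolombSpace K'[X]) :=
    gAch_mono h (gAch_mem (p := p) one_pos (by simpa using hp1.out.ne_one))
  rcases CharP.char_is_prime_or_zero K' p' with hp' | rfl
  · have hp'1 : Fact p'.Prime := ⟨hp'⟩
    by_contra hne
    have h2 : ¬ p ∣ p' := fun hd => hne ((Nat.prime_dvd_prime_iff_eq hp1.out hp').1 hd)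
    exact gAch_not_dvd (p := p') (gAch_mono h (gAch_mem (p := p) hp'.pos h2)) hp'.ne_zero dvd_rfl
  · have : CharZero K' := CharP.charP_to_charZero K'
    exact absurd (gAch_zero h1) (by simp)

/-- Let `K, K'` be separably closed fields of characteristic `p` and `p'`
respectively. If the Golomb spaces `G(K[X])` and `G(K'[X])` are homeomorphic, then
`p = p'`. -/
theorem char_eq_of_golomb_homeomorph (K : Type*) [Field K] [IsSepClosed K]
    (K' : Type*) [Field K'] [IsSepClosed K'] (p p' : ℕ) [CharP K p] [CharP K' p']
    (h : Nonempty (GolombSpace (Polynomial K) ≃ₜ GolombSpace (Polynomial K'))) :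
    p = p' := by
  obtain ⟨h⟩ := h
  by_cases hp : p = 0
  · by_cases hp' : p' = 0
    · rw [hp, hp']
    · exact (gchar_aux K' K p' p h.symm hp').symm
  · exact gchar_aux K K' p p' h hp

end
end

section
/- Let R be a Dedekind domain with torsion ideal class group which is power separated and has the almost Dirichlet property, let S be a Dedekind domain, and let h : G(S) → G(R) be a homeomorphism of the Golomb spaces. Then h sends almost prime elements of S to almost prime elements of R. -/
open Polynomial Filter

noncomputable section

/-- An element of a domain is almost prime if it is irreducible and contained in a unique
maximal ideal. -/
def AlmostPrime {R : Type*} [CommRing R] (b : R) : Prop :=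
  Irreducible b ∧ ∃! P : Ideal R, P.IsMaximal ∧ b ∈ P

/-- `R` has the almost Dirichlet property if every coprime coset `x + I` contains an almost
prime element. -/
def HasAlmostDirichlet (R : Type*) [CommRing R] : Prop :=
  ∀ (x : R) (I : Ideal R), x ≠ 0 → I ≠ ⊥ → Ideal.span {x} ⊔ I = ⊤ →
    ∃ b : R, (∃ i ∈ I, b = x + i) ∧ AlmostPrime b

/-- `G_{{P}}(R)`: the nonzero elements contained in the maximal ideal `P` and in no other
maximal ideal. -/
def golombGsingle {R : Type*} [CommRing R] (P : Ideal R) : Set (GolombSpace R) :=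
  {x | (x : R) ∈ P ∧ ∀ Q : Ideal R, Q.IsMaximal → (x : R) ∈ Q → Q = P}

/-- `R` is power separated if for every maximal ideal `P` and every `b ∈ G_{{P}}(R)`, the
closure of `⟨b⟩` in the Golomb topology meets `G_{{P}}(R)` exactly in `⟨b⟩`. -/
def PowerSeparated (R : Type*) [CommRing R] : Prop :=
  ∀ P : Ideal R, P.IsMaximal → ∀ b : GolombSpace R, b ∈ golombGsingle P →
    closure (golombPow (b : R)) ∩ golombGsingle P = golombPow (b : R)

set_option linter.overlappingInstances false
set_option linter.unusedSectionVars false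

section Aux

open Topology

variable {R : Type*} [CommRing R]

theorem gol_coprime_iff (x : R) (I : Ideal R) :
    Ideal.span {x} ⊔ I = ⊤ ↔ ∀ P : Ideal R, P.IsMaximal → x ∈ P → ¬ I ≤ P := by
  constructor
  · intro h P hP hx hI
    apply hP.ne_top
    rw [eq_top_iff, ← h]
    exact sup_le ((Ideal.span_singleton_le_iff_mem P).2 hx) hI
  · intro h
    by_contra hne
    obtain ⟨P, hP, hle⟩ := Ideal.exists_le_maximal _ hne
    exact h P hP ((Ideal.span_singleton_le_iff_mem P).1 (le_sup_left.trans hle))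
      (le_sup_right.trans hle)

theorem gol_isOpen (x : R) (hx : x ≠ 0) (I : Ideal R) (hI : I ≠ ⊥)
    (hc : Ideal.span {x} ⊔ I = ⊤) : IsOpen {y : GolombSpace R | (y : R) - x ∈ I} := by
  apply TopologicalSpace.isOpen_generateFrom_of_mem
  refine ⟨x, I, hx, hI, hc, ?_⟩
  ext y
  constructor
  · intro hy
    exact ⟨_, hy, by ring⟩
  · rintro ⟨i, hi, hy⟩
    simpa [hy] using hi

theorem gol_mul_ne_bot [IsDomain R] {I J : Ideal R} (hI : I ≠ ⊥) (hJ : J ≠ ⊥) : I * J ≠ ⊥ := by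
  simp [hI, hJ]

theorem gol_mul_left {I J : Ideal R} : I * J ≤ I :=
  Ideal.mul_le.2 fun _ hr _ _ => Ideal.mul_mem_right _ _ hr

theorem gol_mul_right {I J : Ideal R} : I * J ≤ J :=
  Ideal.mul_le.2 fun _ _ _ hs => Ideal.mul_mem_left _ _ hs

theorem gol_max_sup {P I : Ideal R} (hP : P.IsMaximal) (h : ¬ I ≤ P) : P ⊔ I = ⊤ :=
  hP.out.2 _ (left_lt_sup.2 h)

theorem gol_basis [IsDomain R] {U : Set (GolombSpace R)} (hU : IsOpen U) (x : GolombSpace R)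
    (hx : x ∈ U) : ∃ I : Ideal R, I ≠ ⊥ ∧ Ideal.span {(x : R)} ⊔ I = ⊤ ∧
      ∀ y : GolombSpace R, (y : R) - x ∈ I → y ∈ U := by
  induction hU with
  | basic s hs =>
    obtain ⟨x0, I, hx0, hI, hc, rfl⟩ := hs
    obtain ⟨i, hi, hxi⟩ := hx
    refine ⟨I, hI, ?_, ?_⟩
    · rw [gol_coprime_iff] at hc ⊢
      intro P hP hxP hIP
      refine hc P hP ?_ hIP
      have : x0 = (x : R) - i := by rw [hxi]; ring
      rw [this]
      exact P.sub_mem hxP (hIP hi)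
    · intro y hy
      exact ⟨(y : R) - x + i, I.add_mem hy hi, by rw [hxi]; ring⟩
  | univ => exact ⟨⊤, top_ne_bot, by simp, fun _ _ => trivial⟩
  | inter s t _ _ ihs iht =>
    obtain ⟨I, hI, hIc, hI'⟩ := ihs hx.1
    obtain ⟨J, hJ, hJc, hJ'⟩ := iht hx.2
    refine ⟨I * J, gol_mul_ne_bot hI hJ, ?_, ?_⟩
    · rw [Ideal.sup_mul_eq_of_coprime_left hIc, hJc]
    · intro y hy
      exact ⟨hI' y (gol_mul_left hy), hJ' y (gol_mul_right hy)⟩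
  | sUnion S _ ih =>
    obtain ⟨s, hs, hxs⟩ := hx
    obtain ⟨I, hI, hIc, hsub⟩ := ih s hs hxs
    exact ⟨I, hI, hIc, fun y hy => ⟨s, hs, hsub y hy⟩⟩

/-- Coprimality of two elements, in terms of maximal ideals. -/
def GolCop (x y : R) : Prop := ∀ P : Ideal R, P.IsMaximal → x ∈ P → y ∉ P

theorem GolCop.symm {x y : R} (h : GolCop x y) : GolCop y x :=
  fun P hP hy hx => h P hP hx hy

/-- Topological relation characterizing coprime triples. -/
def GolT {X : Type*} [TopologicalSpace X] (x y z : X) : Prop :=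
  ∀ W : Set X, IsOpen W → W.Nonempty → ∃ U V O : Set X, IsOpen U ∧ IsOpen V ∧ IsOpen O ∧
    x ∈ U ∧ y ∈ V ∧ z ∈ O ∧ closure U ∩ closure V ∩ closure O ⊆ closure W

theorem GolT.map {X Y : Type*} [TopologicalSpace X] [TopologicalSpace Y] (h : X ≃ₜ Y) {x y z : X}
    (H : GolT x y z) : GolT (h x) (h y) (h z) := by
  intro W hW hne
  obtain ⟨U, V, O, hU, hV, hO, hx, hy, hz, hsub⟩ := H (h ⁻¹' W) (hW.preimage h.continuous)
    (hne.preimage h.surjective)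
  refine ⟨h.symm ⁻¹' U, h.symm ⁻¹' V, h.symm ⁻¹' O, hU.preimage h.symm.continuous,
    hV.preimage h.symm.continuous, hO.preimage h.symm.continuous, by simpa, by simpa, by simpa, ?_⟩
  rw [← h.symm.preimage_closure, ← h.symm.preimage_closure, ← h.symm.preimage_closure]
  rw [← h.preimage_closure] at hsub
  intro v hv
  have := hsub (show h.symm v ∈ _ from hv)
  simpa using this

theorem golT_map_iff {X Y : Type*} [TopologicalSpace X] [TopologicalSpace Y] (h : X ≃ₜ Y)
    {x y z : X} : GolT (h x) (h y) (h z) ↔ GolT x y z := by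
  refine ⟨fun H => ?_, GolT.map h⟩
  simpa using H.map h.symm

variable [IsDomain R] [IsDedekindDomain R]

/-- Sufficient condition for membership in the closure of a coset. -/
theorem gol_mem_closure (x : R) (I : Ideal R) (hI : I ≠ ⊥) (v : GolombSpace R)
    (U : Set (GolombSpace R)) (hU : ∀ y : GolombSpace R, (y : R) - x ∈ I → y ∈ U)
    (H : ∀ L : Ideal R, Ideal.span {(v : R)} ⊔ L = ⊤ → (v : R) - x ∈ L ⊔ I) : v ∈ closure U := by
  rw [mem_closure_iff]
  intro O hO hv
  obtain ⟨L, hL, hLc, hL'⟩ := gol_basis hO v hv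
  obtain ⟨l, hl, i, hi, hli⟩ := Submodule.mem_sup.1 (H L hLc)
  -- the common element, corrected to be nonzero
  have key : ∃ s ∈ L * I, (v : R) - l + s ≠ 0 := by
    by_cases h0 : (v : R) - l = 0
    · obtain ⟨s, hs, hs0⟩ := Submodule.exists_mem_ne_zero_of_ne_bot
        (gol_mul_ne_bot hL hI)
      exact ⟨s, hs, by simpa [h0] using hs0⟩
    · exact ⟨0, zero_mem _, by simpa using h0⟩
  obtain ⟨s, hs, hs0⟩ := key
  refine ⟨⟨_, hs0⟩, hL' _ ?_, hU _ ?_⟩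
  · have : (v : R) - l + s - v = s - l := by ring
    simp only [this]
    exact L.sub_mem (gol_mul_left hs) hl
  · have : (v : R) - l + s - x = i + s := by
      have : (v : R) = l + i + x := by rw [hli]; ring
      rw [this]; ring
    simp only [this]
    exact I.add_mem hi (gol_mul_right hs)

theorem gol_max_ne_bot {P : Ideal R} {x : R} (hx : x ≠ 0) (hP : x ∈ P) : P ≠ ⊥ := by
  rintro rfl
  exact hx (by simpa using hP)

theorem gol_factor_s16 (P K : Ideal R) (hP : P.IsMaximal) (hK : K ≠ ⊥) :
    ∃ (e : ℕ) (K' : Ideal R), K = P ^ e * K' ∧ ¬ K' ≤ P := by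
  have hfin : FiniteMultiplicity P K := by
    apply FiniteMultiplicity.of_not_isUnit
    · rw [Ideal.isUnit_iff]; exact hP.ne_top
    · exact hK
  obtain ⟨K', h1, h2⟩ := hfin.exists_eq_pow_mul_and_not_dvd
  exact ⟨_, K', h1, fun h => h2 (Ideal.dvd_iff_le.2 h)⟩

theorem gol_max_pow_cop {P I : Ideal R} (hP : P.IsMaximal) (h : ¬ I ≤ P) (n : ℕ) :
    P ^ n ⊔ I = ⊤ :=
  Ideal.pow_sup_eq_top (gol_max_sup hP h)

theorem gol_span_sup_pow {P : Ideal R} (hP : P.IsMaximal) {w : R} (hw : w ∉ P) (n : ℕ) :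
    Ideal.span {w} ⊔ P ^ n = ⊤ := by
  rw [sup_comm]
  exact gol_max_pow_cop hP (fun h => hw (h (Ideal.mem_span_singleton_self w))) n

/-- `GolT x y z` forces `x` and `y` to be coprime. -/
theorem golT_cop {x y z : GolombSpace R} (H : GolT x y z) : GolCop (x : R) (y : R) := by
  intro P hP hxP hyP
  have hPb : P ≠ ⊥ := gol_max_ne_bot x.2 hxP
  obtain ⟨z', hz'P, hz'⟩ : ∃ z' : R, z' ∉ P ∧ ((z : R) ∉ P → z' = z) := by
    by_cases hz : (z : R) ∈ P
    · exact ⟨1, hP.isPrime.one_notMem, fun h => absurd hz h⟩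
    · exact ⟨z, hz, fun _ => rfl⟩
  obtain ⟨t, htP, ht2⟩ : ∃ t ∈ P, t ∉ P ^ 2 := by
    have := Ideal.pow_right_strictAnti P hPb hP.ne_top (show 1 < 2 by norm_num)
    obtain ⟨t, h1, h2⟩ := SetLike.exists_of_lt this
    exact ⟨t, by simpa using h1, h2⟩
  have hwP : z' + t ∉ P := fun h => hz'P (by simpa using P.sub_mem h htP)
  have hw0 : z' + t ≠ 0 := fun h => hwP (by rw [h]; exact P.zero_mem)
  have hP2 : P ^ 2 ≠ ⊥ := pow_ne_zero 2 hPb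
  obtain ⟨U, V, O, hU, hV, hO, hx, hy, hz, hsub⟩ := H
    {y : GolombSpace R | (y : R) - (z' + t) ∈ P ^ 2}
    (gol_isOpen _ hw0 _ hP2 (gol_span_sup_pow hP hwP 2)) ⟨⟨_, hw0⟩, by simp⟩
  obtain ⟨I, hI, hIc, hI'⟩ := gol_basis hU x hx
  obtain ⟨J, hJ, hJc, hJ'⟩ := gol_basis hV y hy
  obtain ⟨K, hK, hKc, hK'⟩ := gol_basis hO z hz
  have hIP := (gol_coprime_iff _ _).1 hIc P hP hxP
  have hJP := (gol_coprime_iff _ _).1 hJc P hP hyP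
  obtain ⟨e, K', rfl, hK'P⟩ := gol_factor_s16 P K hP hK
  have hM : ¬ I * J * K' ≤ P := by
    rw [hP.isPrime.mul_le, hP.isPrime.mul_le]
    tauto
  have htop := gol_max_pow_cop hP hM (e + 2)
  obtain ⟨q, hq, m, hm, hqm⟩ := Submodule.mem_sup.1 ((Ideal.eq_top_iff_one _).1 htop)
  have hv : z' * m - z' = - (z' * q) := by
    have : m = 1 - q := by rw [← hqm]; ring
    rw [this]; ring
  have hvq : z' * m - z' ∈ P ^ (e + 2) := by
    rw [hv]; exact neg_mem (Ideal.mul_mem_left _ _ hq)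
  have hv2 : z' * m - z' ∈ P ^ 2 := Ideal.pow_le_pow_right (by omega) hvq
  have hve : z' * m - z' ∈ P ^ e := Ideal.pow_le_pow_right (by omega) hvq
  have hvP : z' * m ∉ P := fun h => hz'P (by
    simpa using P.sub_mem h (Ideal.pow_le_self (by norm_num) hv2))
  have hv0 : z' * m ≠ 0 := fun h => hvP (by rw [h]; exact P.zero_mem)
  have hmem : z' * m ∈ I * J * K' := Ideal.mul_mem_left _ _ hm
  have hmI : z' * m ∈ I := gol_mul_left (gol_mul_left hmem)
  have hmJ : z' * m ∈ J := gol_mul_right (gol_mul_left hmem)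
  have hmK : z' * m ∈ K' := gol_mul_right hmem
  have hcop : ∀ A : Ideal R, z' * m ∈ A → ∀ L : Ideal R,
      Ideal.span {z' * m} ⊔ L = ⊤ → L ⊔ A = ⊤ := by
    intro A hA L hL
    rw [eq_top_iff, ← hL]
    exact sup_le (((Ideal.span_singleton_le_iff_mem A).2 hA).trans le_sup_right) le_sup_left
  have hmemcl : (⟨z' * m, hv0⟩ : GolombSpace R) ∈ closure U ∩ closure V ∩ closure O := by
    refine ⟨⟨?_, ?_⟩, ?_⟩
    · exact gol_mem_closure (x : R) I hI _ U hI' fun L hL => by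
        rw [hcop I hmI L hL]; trivial
    · exact gol_mem_closure (y : R) J hJ _ V hJ' fun L hL => by
        rw [hcop J hmJ L hL]; trivial
    · refine gol_mem_closure (z : R) _ hK _ O hK' fun L hL => ?_
      rw [Ideal.sup_mul_eq_of_coprime_right (hcop K' hmK L hL)]
      apply Ideal.mem_sup_right
      by_cases hzP : (z : R) ∈ P
      · have h1 := (gol_coprime_iff _ _).1 hKc P hP hzP
        have he : e = 0 := by
          by_contra he
          exact h1 (gol_mul_left.trans (Ideal.pow_le_self he))
        subst he
        simp
      · rw [← hz' hzP]; exact hve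
  have := hsub hmemcl
  rw [mem_closure_iff] at this
  obtain ⟨p, hp1, hp2⟩ := this {y : GolombSpace R | (y : R) - (z' * m) ∈ P ^ 2}
    (gol_isOpen _ hv0 _ hP2 (gol_span_sup_pow hP hvP 2)) (by simp)
  apply ht2
  have : t = ((p : R) - z' * m) - ((p : R) - (z' + t)) + (z' * m - z') := by ring
  rw [this]
  exact Ideal.add_mem _ (Ideal.sub_mem _ hp1 hp2) hv2

theorem gol_pair {P : Ideal R} (hP : P.IsMaximal) {x y : GolombSpace R} (hPb : P ≠ ⊥) (hxy : x ≠ y)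
    (hx : (x : R) ∉ P) (hy : (y : R) ∉ P) :
    {v : GolombSpace R | (v : R) ∈ P} ∈ (𝓝 x).lift' closure ⊓ (𝓝 y).lift' closure := by
  obtain ⟨N, hN⟩ : ∃ N : ℕ, (x : R) - y ∉ P ^ N := by
    by_contra! hcon
    have h1 := Ideal.iInf_pow_eq_bot_of_isDomain P hP.ne_top
    have h2 : (x : R) - y ∈ (⨅ i : ℕ, P ^ i) := by
      rw [Ideal.mem_iInf]; exact hcon
    rw [h1, Ideal.mem_bot, sub_eq_zero] at h2
    exact hxy (Subtype.ext h2)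
  have hPN : P ^ N ≠ ⊥ := pow_ne_zero N hPb
  have key : ∀ x : GolombSpace R, (x : R) ∉ P →
      closure {v : GolombSpace R | (v : R) - x ∈ P ^ N} ∈ (𝓝 x).lift' closure := fun x hx =>
    Filter.mem_lift' ((gol_isOpen _ x.2 _ hPN (gol_span_sup_pow hP hx N)).mem_nhds (by simp))
  have key2 : ∀ (x v : GolombSpace R), v ∈ closure {v : GolombSpace R | (v : R) - x ∈ P ^ N} →
      (v : R) ∉ P → (v : R) - x ∈ P ^ N := by
    intro x v hv hvP
    rw [mem_closure_iff] at hv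
    obtain ⟨p, hp1, hp2⟩ := hv _ (gol_isOpen _ v.2 _ hPN (gol_span_sup_pow hP hvP N)) (by simp)
    have : (v : R) - x = ((p : R) - x) - ((p : R) - v) := by ring
    rw [this]
    exact Ideal.sub_mem _ hp2 hp1
  refine Filter.mem_of_superset (Filter.inter_mem_inf (key x hx) (key y hy)) ?_
  rintro v ⟨h1, h2⟩
  by_contra hvP
  apply hN
  have : (x : R) - y = ((v : R) - y) - ((v : R) - x) := by ring
  rw [this]
  exact Ideal.sub_mem _ (key2 y v h2 hvP) (key2 x v h1 hvP)

theorem gol_finite_max (I : Ideal R) (hI : I ≠ ⊥) :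
    {P : Ideal R | P.IsMaximal ∧ I ≤ P}.Finite := by
  have := Ideal.finite_factors (show I ≠ 0 from hI)
  refine (this.image (fun v => v.asIdeal)).subset ?_
  rintro P ⟨hP, hle⟩
  have hPb : P ≠ ⊥ := by
    rintro rfl
    exact hI (le_bot_iff.1 hle)
  exact ⟨⟨P, hP.isPrime, hPb⟩, Ideal.dvd_iff_le.2 hle, rfl⟩

theorem golT_of_cop {x y z : GolombSpace R} (hxy : x ≠ y) (hxz : x ≠ z) (hyz : y ≠ z)
    (cxy : GolCop (x : R) y) (cxz : GolCop (x : R) z) (cyz : GolCop (y : R) z) : GolT x y z := by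
  intro W hW ⟨w, hw⟩
  obtain ⟨I, hI, hIc, hI'⟩ := gol_basis hW w hw
  have hmem : closure W ∈
      (𝓝 x).lift' closure ⊓ (𝓝 y).lift' closure ⊓ (𝓝 z).lift' closure := by
    have h1 : (⋂ P ∈ {P : Ideal R | P.IsMaximal ∧ I ≤ P}, {v : GolombSpace R | (v : R) ∈ P}) ∈
        (𝓝 x).lift' closure ⊓ (𝓝 y).lift' closure ⊓ (𝓝 z).lift' closure := by
      rw [Filter.biInter_mem (gol_finite_max I hI)]
      rintro P ⟨hP, hle⟩
      have hPb : P ≠ ⊥ := by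
        rintro rfl
        exact hI (le_bot_iff.1 hle)
      by_cases hx : (x : R) ∈ P
      · have := gol_pair hP hPb hyz (cxy P hP hx) (cxz P hP hx)
        exact (inf_le_inf_right ((𝓝 z).lift' closure) (inf_le_right (a := (𝓝 x).lift' closure) (b := (𝓝 y).lift' closure)) : _ ≤ _) this
      · by_cases hy : (y : R) ∈ P
        · have := gol_pair hP hPb hxz hx (cyz P hP hy)
          exact (inf_le_inf_right ((𝓝 z).lift' closure) (inf_le_left (a := (𝓝 x).lift' closure) (b := (𝓝 y).lift' closure)) : _ ≤ _) this
        · exact inf_le_left (a := (𝓝 x).lift' closure ⊓ (𝓝 y).lift' closure)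
            (gol_pair hP hPb hxy hx hy)
    refine Filter.mem_of_superset h1 ?_
    intro v hv
    simp only [Set.mem_iInter, Set.mem_ofPred_eq] at hv
    refine gol_mem_closure (w : R) I hI v W hI' fun L hL => ?_
    have : L ⊔ I = ⊤ := by
      by_contra hne
      obtain ⟨P, hP, hle⟩ := Ideal.exists_le_maximal _ hne
      exact (gol_coprime_iff _ _).1 hL P hP (hv P ⟨hP, le_sup_right.trans hle⟩)
        (le_sup_left.trans hle)
    rw [this]; trivial
  obtain ⟨s, hs, C, hC, hsub⟩ := Filter.mem_inf_iff_superset.1 hmem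
  obtain ⟨A, hA, B, hB, hsub'⟩ := Filter.mem_inf_iff_superset.1 hs
  have key : ∀ (x : GolombSpace R) (A : Set (GolombSpace R)), A ∈ (𝓝 x).lift' closure →
      ∃ U, IsOpen U ∧ x ∈ U ∧ closure U ⊆ A := by
    intro x A hA
    obtain ⟨t, ht, htA⟩ := (Filter.mem_lift'_sets (monotone_closure _)).1 hA
    obtain ⟨U, hUt, hU, hxU⟩ := mem_nhds_iff.1 ht
    exact ⟨U, hU, hxU, (closure_mono hUt).trans htA⟩
  obtain ⟨U, hU, hxU, hUA⟩ := key x A hA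
  obtain ⟨V, hV, hyV, hVB⟩ := key y B hB
  obtain ⟨O, hO, hzO, hOC⟩ := key z C hC
  refine ⟨U, V, O, hU, hV, hO, hxU, hyV, hzO, ?_⟩
  rintro v ⟨⟨h1, h2⟩, h3⟩
  exact hsub ⟨hsub' ⟨hUA h1, hVB h2⟩, hOC h3⟩

theorem gol_cop_iff_of_ne [Infinite R] {x y : GolombSpace R} (hxy : x ≠ y) :
    GolCop (x : R) y ↔ ∃ z : GolombSpace R, x ≠ z ∧ y ≠ z ∧ GolT x y z := by
  constructor
  · intro h
    have hinj : Function.Injective (fun t : R => 1 + (x : R) * y * t) := by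
      intro s t hst
      simpa [x.2, y.2] using hst
    have hfin : ((fun t : R => 1 + (x : R) * y * t) ⁻¹' {0, (x : R), (y : R)}).Finite :=
      Set.Finite.preimage hinj.injOn (by simp)
    obtain ⟨t, ht⟩ := hfin.exists_notMem
    simp only [Set.mem_preimage, Set.mem_insert_iff, Set.mem_singleton_iff, not_or] at ht
    obtain ⟨h0, h1, h2⟩ := ht
    refine ⟨⟨_, h0⟩, fun h => h1 (congrArg Subtype.val h).symm,
      fun h => h2 (congrArg Subtype.val h).symm, ?_⟩
    refine golT_of_cop hxy (fun h => h1 (congrArg Subtype.val h).symm)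
      (fun h => h2 (congrArg Subtype.val h).symm) h ?_ ?_
    · intro P hP hx hz
      apply hP.isPrime.one_notMem
      have : (1 : R) = (1 + (x : R) * y * t) - x * (y * t) := by ring
      rw [this]
      exact P.sub_mem hz (Ideal.mul_mem_right _ _ hx)
    · intro P hP hx hz
      apply hP.isPrime.one_notMem
      have : (1 : R) = (1 + (x : R) * y * t) - y * (x * t) := by ring
      rw [this]
      exact P.sub_mem hz (Ideal.mul_mem_right _ _ hx)
  · rintro ⟨z, _, _, h⟩
    exact golT_cop h

theorem gol_self_iff (x : GolombSpace R) :
    GolCop (x : R) x ↔ ∀ y : GolombSpace R, x ≠ y → GolCop (x : R) y := by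
  constructor
  · intro h y _ P hP hx
    exact absurd hx (h P hP hx)
  · intro h P hP hx _
    have hne : (x : R) * x ≠ 0 := mul_ne_zero x.2 x.2
    refine h ⟨_, hne⟩ ?_ P hP hx (Ideal.mul_mem_left _ _ hx)
    intro heq
    have h1 : (x : R) = x * x := congrArg Subtype.val heq
    have h2 : (x : R) = 1 := (mul_left_cancel₀ x.2 (by rw [mul_one]; exact h1)).symm
    rw [h2] at hx
    exact hP.isPrime.one_notMem hx

theorem gol_cop_map {S : Type*} [CommRing S] [IsDomain S] [IsDedekindDomain S] [Infinite R]
    [Infinite S] (h : GolombSpace S ≃ₜ GolombSpace R) (x y : GolombSpace S) :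
    GolCop (h x : R) (h y : R) ↔ GolCop (x : S) (y : S) := by
  have key : ∀ x y : GolombSpace S, x ≠ y →
      (GolCop (h x : R) (h y : R) ↔ GolCop (x : S) (y : S)) := by
    intro x y hxy
    rw [gol_cop_iff_of_ne hxy, gol_cop_iff_of_ne (h.injective.ne hxy), h.surjective.exists]
    simp only [golT_map_iff, h.injective.ne_iff]
  by_cases hxy : x = y
  · subst hxy
    rw [gol_self_iff, gol_self_iff, h.surjective.forall]
    refine forall_congr' fun z => ?_
    rw [h.injective.ne_iff]
    exact imp_congr_right fun hz => key x z hz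
  · exact key x y hxy

theorem gol_single_iff (x : GolombSpace R) :
    (∃! P : Ideal R, P.IsMaximal ∧ (x : R) ∈ P) ↔ ¬ GolCop (x : R) x ∧
      ∀ z w : GolombSpace R, GolCop (z : R) w → GolCop (z : R) x ∨ GolCop (w : R) x := by
  constructor
  · rintro ⟨P, ⟨hP, hxP⟩, huniq⟩
    refine ⟨fun h => h P hP hxP hxP, fun z w hzw => ?_⟩
    by_cases hz : (z : R) ∈ P
    · right
      intro Q hQ hwQ hxQ
      rw [huniq Q ⟨hQ, hxQ⟩] at hwQ
      exact hzw P hP hz hwQ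
    · left
      intro Q hQ hzQ hxQ
      rw [huniq Q ⟨hQ, hxQ⟩] at hzQ
      exact hz hzQ
  · rintro ⟨h1, h2⟩
    simp only [GolCop] at h1
    push Not at h1
    obtain ⟨P, hP, hxP, _⟩ := h1
    refine ⟨P, ⟨hP, hxP⟩, ?_⟩
    rintro Q ⟨hQ, hxQ⟩
    by_contra hne
    have hcop : Q ⊔ P = ⊤ := Ideal.IsMaximal.coprime_of_ne hQ hP hne
    -- `w ∈ Q` with `w ∉ P`
    obtain ⟨q, hq, p, hp, hqp⟩ := Submodule.mem_sup.1 ((Ideal.eq_top_iff_one _).1 hcop)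
    have hqP : q ∉ P := fun h => hP.isPrime.one_notMem (by rw [← hqp]; exact P.add_mem h hp)
    have hq0 : q ≠ 0 := fun h => hqP (by rw [h]; exact P.zero_mem)
    have hc2 : Ideal.span {q} ⊔ P = ⊤ := by simpa using gol_span_sup_pow hP hqP 1
    obtain ⟨s, hs, z, hz, hsz⟩ := Submodule.mem_sup.1 ((Ideal.eq_top_iff_one _).1 hc2)
    have hsQ : s ∈ Q := ((Ideal.span_singleton_le_iff_mem Q).2 hq) hs
    have hz0 : z ≠ 0 := by
      rintro rfl
      apply hQ.isPrime.one_notMem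
      rw [← hsz, add_zero]
      exact hsQ
    have hzw : GolCop z q := by
      intro M hM hzM hqM
      apply hM.isPrime.one_notMem
      rw [← hsz]
      exact M.add_mem (((Ideal.span_singleton_le_iff_mem M).2 hqM) hs) hzM
    rcases h2 ⟨z, hz0⟩ ⟨q, hq0⟩ hzw with h | h
    · exact h P hP hz hxP
    · exact h Q hQ hq hxQ

theorem gol_single_map {S : Type*} [CommRing S] [IsDomain S] [IsDedekindDomain S] [Infinite R]
    [Infinite S] (h : GolombSpace S ≃ₜ GolombSpace R) (x : GolombSpace S) :
    (∃! P : Ideal R, P.IsMaximal ∧ (h x : R) ∈ P) ↔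
      (∃! P : Ideal S, P.IsMaximal ∧ (x : S) ∈ P) := by
  rw [gol_single_iff, gol_single_iff, h.surjective.forall]
  simp only [h.surjective.forall, gol_cop_map]

/-- If `x` lies in a unique maximal ideal `Q`, then `(x)` is a power of `Q`. -/
theorem gol_span_eq_pow {Q : Ideal R} (hQ : Q.IsMaximal) {x : R} (hx : x ≠ 0)
    (h : ∀ M : Ideal R, M.IsMaximal → x ∈ M → M = Q) : ∃ k : ℕ, Ideal.span {x} = Q ^ k := by
  obtain ⟨k, K, hk, hK⟩ := gol_factor_s16 Q (Ideal.span {x}) hQ (by simpa using hx)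
  refine ⟨k, ?_⟩
  have : K = ⊤ := by
    by_contra hne
    obtain ⟨M, hM, hle⟩ := Ideal.exists_le_maximal _ hne
    have hxM : x ∈ M := by
      have : Ideal.span {x} ≤ M := by rw [hk]; exact gol_mul_right.trans hle
      exact (Ideal.span_singleton_le_iff_mem M).1 this
    rw [h M hM hxM] at hle
    exact hK hle
  rw [hk, this, Ideal.mul_top]

theorem gol_mem_pow {Q : Ideal R} (hQ : Q.IsMaximal) {a : R} (ha : Irreducible a)
    (hQa : ∀ M : Ideal R, M.IsMaximal → a ∈ M → M = Q) (y : R) :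
    y ≠ 0 → ¬ IsUnit y → (∀ M : Ideal R, M.IsMaximal → y ∈ M → M = Q) →
    ∃ (u : R) (n : ℕ), IsUnit u ∧ 1 ≤ n ∧ y = u * a ^ n := by
  induction y using (wellFounded_dvdNotUnit (α := R)).induction with
  | _ y ih =>
  intro hy hyu hQy
  obtain ⟨k, hk⟩ := gol_span_eq_pow hQ ha.ne_zero hQa
  obtain ⟨j, hj⟩ := gol_span_eq_pow hQ hy hQy
  rcases le_total k j with hkj | hkj
  · have hle : Ideal.span {y} ≤ Ideal.span {a} := by
      rw [hk, hj]; exact Ideal.pow_le_pow_right hkj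
    obtain ⟨s, rfl⟩ := Ideal.span_singleton_le_span_singleton.1 hle
    by_cases hs : IsUnit s
    · exact ⟨s, 1, hs, le_rfl, by ring⟩
    · have hs0 : s ≠ 0 := right_ne_zero_of_mul hy
      obtain ⟨u, n, hu, hn, hsn⟩ := ih s ⟨hs0, a, ha.not_isUnit, mul_comm _ _⟩ hs0 hs
        (fun M hM hsM => hQy M hM (Ideal.mul_mem_left _ _ hsM))
      exact ⟨u, n + 1, hu, by omega, by rw [hsn]; ring⟩
  · have hle : Ideal.span {a} ≤ Ideal.span {y} := by
      rw [hk, hj]; exact Ideal.pow_le_pow_right hkj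
    obtain ⟨s, hs⟩ := Ideal.span_singleton_le_span_singleton.1 hle
    have hsu : IsUnit s := (ha.isUnit_or_isUnit hs).resolve_left hyu
    obtain ⟨u, rfl⟩ := hsu
    exact ⟨(u⁻¹ : Rˣ), 1, Units.isUnit _, le_rfl, by
      rw [hs, pow_one, mul_comm y, Units.inv_mul_cancel_left]⟩

theorem gol_infinite {a : R} (ha : a ≠ 0) (hu : ¬ IsUnit a) : Infinite R := by
  by_contra hfin
  rw [not_infinite_iff_finite] at hfin
  exact hu ((Finite.isField_of_domain R).mul_inv_cancel ha |>.elim fun b hb =>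
    IsUnit.of_mul_eq_one b hb)


/-- The map `y ↦ u * y ^ k` on the Golomb space. -/
def golPowMap (u : R) (hu : IsUnit u) (k : ℕ) (y : GolombSpace R) : GolombSpace R :=
  ⟨u * (y : R) ^ k, mul_ne_zero hu.ne_zero (pow_ne_zero k y.2)⟩

theorem golPowMap_mem (u : R) (hu : IsUnit u) (k : ℕ) (hk : 1 ≤ k) (y : GolombSpace R)
    (M : Ideal R) (hM : M.IsMaximal) : (golPowMap u hu k y : R) ∈ M ↔ (y : R) ∈ M := by
  simp only [golPowMap]
  rw [Ideal.unit_mul_mem_iff_mem M hu]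
  exact ⟨hM.isPrime.mem_of_pow_mem k, fun h => Ideal.pow_mem_of_mem M h k (by omega)⟩

theorem golPowMap_continuous (u : R) (hu : IsUnit u) (k : ℕ) (hk : 1 ≤ k) :
    Continuous (golPowMap u hu k) := by
  rw [continuous_def]
  intro O hO
  rw [isOpen_iff_forall_mem_open]
  intro x hx
  obtain ⟨I, hI, hIc, hI'⟩ := gol_basis hO _ hx
  refine ⟨{y : GolombSpace R | (y : R) - x ∈ I}, ?_, gol_isOpen _ x.2 _ hI ?_, by simp⟩
  · intro y hy
    apply hI'
    simp only [golPowMap]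
    rw [← mul_sub]
    exact Ideal.mul_mem_left _ _ (Ideal.mem_of_dvd _ (sub_dvd_pow_sub_pow _ _ k) hy)
  · rw [gol_coprime_iff] at hIc ⊢
    intro P hP hxP
    exact hIc P hP ((golPowMap_mem u hu k hk x P hP).2 hxP)

theorem gol_single_of_mem {P : Ideal R} (hP : P.IsMaximal) {x : GolombSpace R}
    (hx : x ∈ golombGsingle P) : ∃! P : Ideal R, P.IsMaximal ∧ (x : R) ∈ P :=
  ⟨P, ⟨hP, hx.1⟩, fun Q hQ => hx.2 Q hQ.1 hQ.2⟩

theorem gol_same {P : Ideal R} {x y : GolombSpace R}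
    (hx : x ∈ golombGsingle P) (hy : ∃! P : Ideal R, P.IsMaximal ∧ (y : R) ∈ P)
    (hxy : ¬ GolCop (x : R) y) : y ∈ golombGsingle P := by
  simp only [GolCop] at hxy
  push Not at hxy
  obtain ⟨M, hM, hxM, hyM⟩ := hxy
  obtain rfl := hx.2 M hM hxM
  exact ⟨hyM, fun Q hQ hyQ => hy.unique ⟨hQ, hyQ⟩ ⟨hM, hyM⟩⟩

theorem gol_pow_stable {S : Type*} [CommRing S] [IsDomain S] [IsDedekindDomain S] [Infinite R]
    [Infinite S] (h : GolombSpace S ≃ₜ GolombSpace R) {P : Ideal R} (hP : P.IsMaximal)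
    (x : GolombSpace S) (hx : h x ∈ golombGsingle P) (u : S) (hu : IsUnit u) (k : ℕ) (hk : 1 ≤ k) :
    h (golPowMap u hu k x) ∈ golombGsingle P := by
  have hxs := (gol_single_map h x).1 (gol_single_of_mem hP hx)
  obtain ⟨Q, ⟨hQ, hxQ⟩, hun⟩ := hxs
  refine gol_same hx ?_ ?_
  · rw [gol_single_map]
    refine ⟨Q, ⟨hQ, (golPowMap_mem u hu k hk x Q hQ).2 hxQ⟩, ?_⟩
    rintro M ⟨hM, hxM⟩
    exact hun M ⟨hM, (golPowMap_mem u hu k hk x M hM).1 hxM⟩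
  · rw [gol_cop_map]
    intro hc
    exact hc Q hQ hxQ ((golPowMap_mem u hu k hk x Q hQ).2 hxQ)

theorem gol_pow_closure {S : Type*} [CommRing S] [IsDomain S] [IsDedekindDomain S] [Infinite R]
    [Infinite S] (had : HasAlmostDirichlet R)
    (h : GolombSpace S ≃ₜ GolombSpace R) {P : Ideal R} (hP : P.IsMaximal)
    (x : GolombSpace S) (hx : h x ∈ golombGsingle P) (u : S) (hu : IsUnit u) (k : ℕ) (hk : 1 ≤ k) :
    h (golPowMap u hu k x) ∈ closure (golombPow (h x : R)) := by
  have hfx := gol_pow_stable h hP x hx u hu k hk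
  rw [mem_closure_iff]
  intro O hO hmem
  obtain ⟨I, hI, hIc, hI'⟩ := gol_basis hO _ hmem
  have hOI := gol_isOpen _ (h (golPowMap u hu k x)).2 I hI hIc
  have hcont : Continuous (fun y : GolombSpace R => h (golPowMap u hu k (h.symm y))) :=
    h.continuous.comp ((golPowMap_continuous u hu k hk).comp h.symm.continuous)
  obtain ⟨J, hJ, hJc, hJ'⟩ := gol_basis (hOI.preimage hcont) (h x) (by simp)
  have hIx : Ideal.span {(h x : R)} ⊔ I = ⊤ := by
    rw [gol_coprime_iff] at hIc ⊢
    intro M hM hxM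
    obtain rfl := hx.2 M hM hxM
    exact hIc M hM hfx.1
  obtain ⟨p, ⟨i, hi, hpi⟩, hirr, P', ⟨hP', hpP'⟩, hun⟩ := had (h x : R) (I * J) (h x).2
    (gol_mul_ne_bot hI hJ) (by rw [Ideal.sup_mul_eq_of_coprime_left hIx, hJc])
  have hp0 : p ≠ 0 := hirr.ne_zero
  have hq := hJ' ⟨p, hp0⟩ (by
    have : p - (h x : R) = i := by rw [hpi]; ring
    simp only [this]
    exact gol_mul_right hi)
  simp only [Set.mem_preimage, Set.mem_ofPred_eq] at hq
  have hps : h (h.symm ⟨p, hp0⟩) ∈ golombGsingle P' := by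
    rw [h.apply_symm_apply]
    exact ⟨hpP', fun M hM hpM => hun M ⟨hM, hpM⟩⟩
  have hqs := gol_pow_stable h hP' _ hps u hu k hk
  obtain ⟨v, m, hv, hm, hvm⟩ := gol_mem_pow hP' hirr (fun M hM hpM => hun M ⟨hM, hpM⟩) _
    (h (golPowMap u hu k (h.symm ⟨p, hp0⟩))).2
    (fun hunit => hP'.ne_top (Ideal.eq_top_of_isUnit_mem _ hqs.1 hunit)) hqs.2
  have hne : v * (h x : R) ^ m ≠ 0 := mul_ne_zero hv.ne_zero (pow_ne_zero m (h x).2)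
  refine ⟨⟨_, hne⟩, hI' _ ?_, ⟨v, m, hv, hm, rfl⟩⟩
  rw [hvm] at hq
  have e : v * (h x : R) ^ m - (h (golPowMap u hu k x) : R)
      = (v * p ^ m - (h (golPowMap u hu k x) : R)) - v * (p ^ m - (h x : R) ^ m) := by ring
  simp only [e]
  refine Ideal.sub_mem _ hq (Ideal.mul_mem_left _ _ ?_)
  refine Ideal.mem_of_dvd _ (sub_dvd_pow_sub_pow _ _ m) ?_
  have : p - (h x : R) = i := by rw [hpi]; ring
  rw [this]
  exact gol_mul_left hi

end Aux

/-- Let `R` be a Dedekind domain with torsion class group which is power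
separated and has the almost Dirichlet property, let `S` be a Dedekind domain and let
`h : G(S) → G(R)` be a homeomorphism of Golomb spaces. Then `h` sends almost prime
elements of `S` to almost prime elements of `R`. -/
theorem golomb_homeomorph_maps_almostPrime (R S : Type*)
    [CommRing R] [IsDomain R] [IsDedekindDomain R]
    [CommRing S] [IsDomain S] [IsDedekindDomain S]
    (htors : ∀ c : ClassGroup R, IsOfFinOrder c)
    (hps : PowerSeparated R) (had : HasAlmostDirichlet R)
    (h : GolombSpace S ≃ₜ GolombSpace R)
    (a : S) (ha : a ≠ 0) (hap : AlmostPrime a) :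
    AlmostPrime ((h ⟨a, ha⟩ : GolombSpace R) : R) := by

  -- both rings are infinite
  obtain ⟨p0, -, hp0⟩ := had 1 ⊤ one_ne_zero top_ne_bot (by simp)
  have : Infinite R := gol_infinite hp0.1.ne_zero hp0.1.not_isUnit
  have : Infinite S := gol_infinite ha hap.1.not_isUnit
  obtain ⟨hirr, hsingle⟩ := hap
  have hcs : ∃! P : Ideal R, P.IsMaximal ∧ ((h ⟨a, ha⟩ : GolombSpace R) : R) ∈ P :=
    (gol_single_map h ⟨a, ha⟩).2 hsingle
  refine ⟨?_, hcs⟩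
  obtain ⟨Q, ⟨hQ, haQ⟩, hunQ⟩ := hsingle
  obtain ⟨P, ⟨hP, hcP⟩, hunP⟩ := hcs
  have hc : h ⟨a, ha⟩ ∈ golombGsingle P := ⟨hcP, fun M hM hcM => hunP M ⟨hM, hcM⟩⟩
  have haG : (⟨a, ha⟩ : GolombSpace S) ∈ golombGsingle Q :=
    ⟨haQ, fun M hM hcM => hunQ M ⟨hM, hcM⟩⟩
  -- every element of `G_P(R)` is in `⟨h a⟩`
  have key : ∀ x : GolombSpace R, x ∈ golombGsingle P → x ∈ golombPow ((h ⟨a, ha⟩ : R)) := by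
    intro x hx
    obtain ⟨y, rfl⟩ := h.surjective x
    have hy1 := (gol_single_map h y).1 (gol_single_of_mem hP hx)
    have hy2 : y ∈ golombGsingle Q := by
      refine gol_same haG hy1 ?_
      rw [← gol_cop_map h]
      exact fun hcop => hcop P hP hcP hx.1
    obtain ⟨u, k, hu, hk, hyk⟩ := gol_mem_pow hQ hirr haG.2 (y : S) y.2
      (fun hunit => hQ.ne_top (Ideal.eq_top_of_isUnit_mem _ hy2.1 hunit)) hy2.2
    have hyeq : y = golPowMap u hu k ⟨a, ha⟩ := Subtype.ext hyk
    rw [← hps P hP _ hc]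
    refine ⟨?_, hx⟩
    rw [hyeq]
    exact gol_pow_closure had h hP _ hc u hu k hk
  have hnu : ¬ IsUnit ((h ⟨a, ha⟩ : GolombSpace R) : R) :=
    fun hunit => hP.ne_top (Ideal.eq_top_of_isUnit_mem _ hcP hunit)
  generalize hceq : h ⟨a, ha⟩ = c at *
  refine ⟨hnu, ?_⟩
  intro x y hxy
  by_contra! hcon
  have hfac : ∀ z : R, z ∣ (c : R) → ¬ IsUnit z →
      ∃ (u : R) (n : ℕ), IsUnit u ∧ 1 ≤ n ∧ z = u * (c : R) ^ n := by
    intro z hz hzu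
    have hz0 : z ≠ 0 := fun h0 => c.2 (by rw [h0] at hz; exact zero_dvd_iff.1 hz)
    have hall : ∀ M : Ideal R, M.IsMaximal → z ∈ M → M = P :=
      fun M hM hzM => hc.2 M hM (Ideal.mem_of_dvd _ hz hzM)
    obtain ⟨M, hM, hzM⟩ := exists_max_ideal_of_mem_nonunits hzu
    have hzP : z ∈ P := hall M hM hzM ▸ hzM
    exact key ⟨z, hz0⟩ ⟨hzP, hall⟩
  obtain ⟨u, m, hu, hm, hxm⟩ := hfac x ⟨y, hxy⟩ hcon.1
  obtain ⟨v, n, hv, hn, hyn⟩ := hfac y ⟨x, by rw [hxy, mul_comm]⟩ hcon.2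
  apply hnu
  obtain ⟨m, rfl⟩ := Nat.exists_eq_add_of_le hm
  obtain ⟨n, rfl⟩ := Nat.exists_eq_add_of_le hn
  have h1 : (c : R) * 1 = c * (c * (u * v * (c : R) ^ m * (c : R) ^ n)) := by
    rw [mul_one]
    conv_lhs => rw [hxy, hxm, hyn]
    ring
  exact IsUnit.of_mul_eq_one _ (mul_left_cancel₀ c.2 h1).symm

end
end
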